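/- arXiv:1405.3105 — 9 statements merged into one kernel-verified Lean document; each statement's English description precedes it below -/
import Mathlib

section
/- Let 𝕂 be a field of characteristic zero, let q ∈ 𝕂 be nonzero and not a root of unity, let r ∈ 𝕂, and let ζ ∈ 𝕂. Define the 𝕂-linear map τ̂_ζ : 𝕂[z] → 𝕂 by τ̂_ζ(1) = 0 and, for n ≥ 1, τ̂_ζ(z^n) = (1/(1−q^n)) Σ_{i=1}^n t^n_i ζ^i, where t^n_n = 1 and t^n_{n−k} = Σ_{i=1}^k binom(n,i) (r^i q^{n−i}/(1−q^{n−i})) t^{n−i}_{n−k} for k = 1,…,n−1. Then for every polynomial f ∈ 𝕂[z], τ̂_ζ(f(z)) − τ̂_ζ(f(qz+r)) = f(ζ) − f(0). -/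
open Polynomial Finset

/-- The coefficients `t^n_j` from the paper: `t n n = 1` and, for `j < n`,
`t n j = ∑_{i=1}^{n-j} (n choose i) * r^i * q^(n-i)/(1-q^(n-i)) * t (n-i) j`. -/
noncomputable def tCoeff {𝕂 : Type*} [Field 𝕂] (q r : 𝕂) : ℕ → ℕ → 𝕂
  | n, j =>
    if j = n then 1
    else if h : j < n then
      ∑ i ∈ Finset.range (n - j),
        (n.choose (i + 1) : 𝕂) *
          (r ^ (i + 1) * q ^ (n - (i + 1)) / (1 - q ^ (n - (i + 1)))) *
          tCoeff q r (n - (i + 1)) j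
    else 0
  termination_by n j => n
  decreasing_by omega

theorem tCoeff_self {𝕂 : Type*} [Field 𝕂] (q r : 𝕂) (n : ℕ) : tCoeff q r n n = 1 := by
  rw [tCoeff]; simp

theorem tCoeff_eq_zero_of_lt {𝕂 : Type*} [Field 𝕂] (q r : 𝕂) {n j : ℕ} (h : n < j) :
    tCoeff q r n j = 0 := by
  rw [tCoeff, if_neg (by omega), dif_neg (by omega)]

theorem tCoeff_succ_of_le {𝕂 : Type*} [Field 𝕂] (q r : 𝕂) {n j : ℕ} (hj : 1 ≤ j) (h : j ≤ n) :
    tCoeff q r (n + 1) j = ∑ i ∈ Finset.range n,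
      ((n + 1).choose (i + 1) : 𝕂) * (r ^ (i + 1) * q ^ (n - i) / (1 - q ^ (n - i))) *
        tCoeff q r (n - i) j := by
  rw [tCoeff, if_neg (by omega), dif_pos (by omega)]
  simp only [Nat.add_sub_add_right]
  refine Finset.sum_subset (fun i hi => ?_) (fun i _ hi => ?_)
  · simp only [Finset.mem_range] at hi ⊢
    omega
  · rw [Finset.mem_range] at hi
    rw [tCoeff_eq_zero_of_lt q r (by omega), mul_zero]

theorem sum_tCoeff_mul_pow_succ {𝕂 : Type*} [Field 𝕂] (q r ζ : 𝕂) (n : ℕ) :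
    ∑ j ∈ Finset.Icc 1 (n + 1), tCoeff q r (n + 1) j * ζ ^ j =
      ∑ i ∈ Finset.range n,
        ((n + 1).choose (i + 1) : 𝕂) * (r ^ (i + 1) * q ^ (n - i) / (1 - q ^ (n - i))) *
          ∑ j ∈ Finset.Icc 1 (n - i), tCoeff q r (n - i) j * ζ ^ j + ζ ^ (n + 1) := by
  rw [Finset.sum_Icc_succ_top (by omega), tCoeff_self, one_mul]
  congr 1
  have hext : ∀ i, ∑ j ∈ Finset.Icc 1 (n - i), tCoeff q r (n - i) j * ζ ^ j =
      ∑ j ∈ Finset.Icc 1 n, tCoeff q r (n - i) j * ζ ^ j := fun i => by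
    refine Finset.sum_subset (Finset.Icc_subset_Icc le_rfl (by omega)) (fun j hj hj' => ?_)
    rw [Finset.mem_Icc] at hj hj'
    rw [tCoeff_eq_zero_of_lt q r (by omega), zero_mul]
  simp only [hext, Finset.mul_sum]
  rw [Finset.sum_comm]
  refine Finset.sum_congr rfl fun j hj => ?_
  rw [Finset.mem_Icc] at hj
  rw [tCoeff_succ_of_le q r hj.1 hj.2, Finset.sum_mul]
  exact Finset.sum_congr rfl fun i _ => mul_assoc _ _ _

theorem map_affine_pow_succ {𝕂 : Type*} [Field 𝕂] (q r : 𝕂) (τ : Polynomial 𝕂 →ₗ[𝕂] 𝕂)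
    (h1 : τ 1 = 0) (n : ℕ) :
    τ ((Polynomial.C q * Polynomial.X + Polynomial.C r) ^ (n + 1)) =
      ∑ i ∈ Finset.range n, ((n + 1).choose (i + 1) : 𝕂) * (r ^ (i + 1) * q ^ (n - i)) *
        τ (Polynomial.X ^ (n - i)) + q ^ (n + 1) * τ (Polynomial.X ^ (n + 1)) := by
  have hterm : ∀ m, τ (Polynomial.C r ^ m * (Polynomial.C q * Polynomial.X) ^ (n + 1 - m) *
      ((n + 1).choose m : Polynomial 𝕂)) =
      ((n + 1).choose m : 𝕂) * (r ^ m * q ^ (n + 1 - m)) * τ (Polynomial.X ^ (n + 1 - m)) := by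
    intro m
    rw [← smul_eq_mul (_ * _ : 𝕂) (τ _), ← map_smul, Polynomial.smul_eq_C_mul]
    congr 1
    simp only [map_mul, map_pow, map_natCast, mul_pow]
    ring
  rw [add_comm, add_pow, map_sum, Finset.sum_congr rfl fun m _ => hterm m,
    Finset.sum_range_succ, Finset.sum_range_succ']
  simp [h1]

/-- for the 𝕂-linear map `τ̂_ζ` on `𝕂[z]` determined on the monomial basis by
`τ̂_ζ(1) = 0` and `τ̂_ζ(z^n) = (1-q^n)⁻¹ ∑_{i=1}^n t^n_i ζ^i` for `n ≥ 1`, one has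
`τ̂_ζ(f(z)) − τ̂_ζ(f(qz+r)) = f(ζ) − f(0)` for every polynomial `f`. -/
theorem stmt2 {𝕂 : Type*} [Field 𝕂] [CharZero 𝕂] (q r ζ : 𝕂) (hq0 : q ≠ 0)
    (hq : ∀ n : ℕ, n ≠ 0 → q ^ n ≠ 1)
    (τ : Polynomial 𝕂 →ₗ[𝕂] 𝕂)
    (hτ : τ = (Polynomial.basisMonomials 𝕂).constr 𝕂
      (fun n => if n = 0 then 0
        else (1 - q ^ n)⁻¹ * ∑ i ∈ Finset.Icc 1 n, tCoeff q r n i * ζ ^ i))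
    (f : Polynomial 𝕂) :
    τ f - τ (f.comp (Polynomial.C q * Polynomial.X + Polynomial.C r)) =
      f.eval ζ - f.eval 0 := by
  have hX : ∀ n : ℕ, τ (Polynomial.X ^ n) = if n = 0 then 0
      else (1 - q ^ n)⁻¹ * ∑ i ∈ Finset.Icc 1 n, tCoeff q r n i * ζ ^ i := fun n => by
    rw [hτ, Polynomial.X_pow_eq_monomial,
      ← congrFun (Polynomial.coe_basisMonomials (R := 𝕂)) n, Module.Basis.constr_basis]
  have h1 : τ 1 = 0 := by simpa using hX 0
  induction f using Polynomial.induction_on' with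
  | add f g hf hg =>
    simp only [Polynomial.add_comp, map_add, Polynomial.eval_add]
    linear_combination hf + hg
  | monomial n a =>
    rw [← Polynomial.C_mul_X_pow_eq_monomial, Polynomial.mul_comp, Polynomial.C_comp,
      Polynomial.X_pow_comp, ← Polynomial.smul_eq_C_mul, ← Polynomial.smul_eq_C_mul, map_smul,
      map_smul]
    simp only [Polynomial.eval_smul, Polynomial.eval_pow, Polynomial.eval_X, smul_eq_mul,
      ← mul_sub]
    congr 1
    cases n with
    | zero => simp
    | succ n =>
      have hne : 1 - q ^ (n + 1) ≠ 0 := sub_ne_zero.mpr (hq _ n.succ_ne_zero).symm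
      have hS : (1 - q ^ (n + 1)) * τ (Polynomial.X ^ (n + 1)) =
          ∑ j ∈ Finset.Icc 1 (n + 1), tCoeff q r (n + 1) j * ζ ^ j := by
        rw [hX, if_neg n.succ_ne_zero, mul_inv_cancel_left₀ hne]
      have hsum : ∑ i ∈ Finset.range n, ((n + 1).choose (i + 1) : 𝕂) *
            (r ^ (i + 1) * q ^ (n - i)) * τ (Polynomial.X ^ (n - i)) =
          ∑ i ∈ Finset.range n,
            ((n + 1).choose (i + 1) : 𝕂) * (r ^ (i + 1) * q ^ (n - i) / (1 - q ^ (n - i))) *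
              ∑ j ∈ Finset.Icc 1 (n - i), tCoeff q r (n - i) j * ζ ^ j := by
        refine Finset.sum_congr rfl fun i hi => ?_
        rw [Finset.mem_range] at hi
        rw [hX, if_neg (by omega), div_eq_mul_inv]
        ring
      rw [map_affine_pow_succ q r τ h1, hsum, zero_pow n.succ_ne_zero]
      linear_combination hS + sum_tCoeff_mul_pow_succ q r ζ n
end

section
/- Let 𝕂 be a field of characteristic zero, q, r ∈ 𝕂 with q ≠ 0, and p ∈ 𝕂[z] a nonzero polynomial. In the generalized Weyl algebra B(p;q,r), for all k, l, n ∈ ℕ the commutator satisfies [x^n z^k, z^l y^n] = σ^n(s_n(z))·σ^n(z)^{k+l} − s_n(z)·z^{k+l}, where σ is the 𝕂-algebra automorphism of 𝕂[z] with σ(z) = qz + r and s_n(z) = ∏_{m=0}^{n−1} σ^{−m}(p(z)). -/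
open Polynomial

/-- If `w` moves past `z` by twisting `z` with `φ`, then it moves past every polynomial in `z`
by twisting that polynomial with `φ`. -/
theorem mul_aeval_eq_aeval_mul_of_twist {R A : Type*} [CommRing R] [Ring A] [Algebra R A]
    {w z : A} (φ : R[X] ≃ₐ[R] R[X]) (h : w * z = aeval z (φ X) * w) (f : R[X]) :
    w * aeval z f = aeval z (φ f) * w := by
  induction f using Polynomial.induction_on with
  | C a =>
    have hC : φ (C a) = C a := φ.commutes a
    rw [hC, aeval_C, Algebra.commutes]
  | add f g hf hg => simp only [map_add, mul_add, add_mul, hf, hg]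
  | monomial n a ih =>
    rw [pow_succ, ← mul_assoc, map_mul, ← mul_assoc, ih, mul_assoc, aeval_X, h,
      map_mul φ (C a * X ^ n), map_mul (aeval z), mul_assoc]

/-- The twisting relation for a power of `w` is the corresponding power of the twist. -/
theorem pow_mul_aeval_eq_aeval_mul_pow_of_twist {R A : Type*} [CommRing R] [Ring A] [Algebra R A]
    {w z : A} (φ : R[X] ≃ₐ[R] R[X]) (h : w * z = aeval z (φ X) * w) (n : ℕ) (f : R[X]) :
    w ^ n * aeval z f = aeval z ((φ ^ n) f) * w ^ n := by
  induction n with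
  | zero => simp
  | succ n ih =>
    rw [pow_succ', mul_assoc, ih, ← mul_assoc, mul_aeval_eq_aeval_mul_of_twist φ h, mul_assoc,
      pow_succ' φ, AlgEquiv.mul_apply]

/-- in the generalized Weyl algebra `B(p;q,r)`, for all `k, l, n ∈ ℕ`,
`[x^n z^k, z^l y^n] = σ^n(s_n(z))·σ^n(z)^{k+l} − s_n(z)·z^{k+l}`. -/
theorem stmt6 {𝕂 : Type*} [Field 𝕂] [CharZero 𝕂] (q r : 𝕂) (hq : q ≠ 0)
    (p : Polynomial 𝕂) (hp : p ≠ 0)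
    {B : Type*} [Ring B] [Algebra 𝕂 B] (x y z : B)
    (hxy : x * y = aeval (q • z + algebraMap 𝕂 B r) p)
    (hyx : y * x = aeval z p)
    (hxz : x * z = (q • z + algebraMap 𝕂 B r) * x)
    (hyz : y * z = q⁻¹ • ((z - algebraMap 𝕂 B r) * y))
    (σ : Polynomial 𝕂 ≃ₐ[𝕂] Polynomial 𝕂) (hσ : σ X = C q * X + C r)
    (s : ℕ → Polynomial 𝕂) (hs : ∀ n : ℕ, s n = ∏ m ∈ Finset.range n, (σ⁻¹ ^ m) p)
    (k l n : ℕ) :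
    (x ^ n * z ^ k) * (z ^ l * y ^ n) - (z ^ l * y ^ n) * (x ^ n * z ^ k) =
      aeval z ((σ ^ n) (s n)) * (aeval z ((σ ^ n) X)) ^ (k + l) -
        aeval z (s n) * z ^ (k + l) := by
  have hσz : aeval z (σ X) = q • z + algebraMap 𝕂 B r := by
    simp [hσ, Algebra.smul_def]
  have hx : x * z = aeval z (σ X) * x := by rw [hσz, hxz]
  have hσinv : σ⁻¹ X = C q⁻¹ * (X - C r) := by
    apply σ.injective
    have hC (a : 𝕂) : σ (C a) = C a := σ.commutes a
    rw [← AlgEquiv.mul_apply, mul_inv_cancel, AlgEquiv.one_apply, map_mul, map_sub, hC, hC, hσ,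
      add_sub_cancel_right, ← mul_assoc, ← C_mul, inv_mul_cancel₀ hq, C_1, one_mul]
  have hy : y * z = aeval z (σ⁻¹ X) * y := by
    rw [hyz, hσinv]
    simp [Algebra.smul_def, mul_assoc]
  have hxy' : x * y = aeval z (σ p) := by
    have hp' : σ p = p.comp (σ X) := by
      have h := aeval_algHom_apply σ X p
      rw [aeval_X_left_apply] at h
      rw [← h, comp_eq_aeval]
    rw [hxy, hp', aeval_comp, hσz]
  have hs_succ (m : ℕ) : s (m + 1) = s m * (σ⁻¹ ^ m) p := by
    rw [hs, hs, Finset.prod_range_succ]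
  have hxn (m : ℕ) : x ^ m * y ^ m = aeval z ((σ ^ m) (s m)) := by
    induction m with
    | zero => simp [hs]
    | succ m ih =>
      have hcancel : (σ ^ m) ((σ⁻¹ ^ m) p) = p := by
        rw [← AlgEquiv.mul_apply, inv_pow, mul_inv_cancel, AlgEquiv.one_apply]
      rw [pow_succ' x, pow_succ y, mul_assoc, ← mul_assoc (x ^ m), ih, ← mul_assoc,
        mul_aeval_eq_aeval_mul_of_twist σ hx, mul_assoc, hxy', ← map_mul, ← map_mul, hs_succ,
        pow_succ' σ, AlgEquiv.mul_apply, map_mul (σ ^ m), hcancel]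
  have hyn (m : ℕ) : y ^ m * x ^ m = aeval z (s m) := by
    induction m with
    | zero => simp [hs]
    | succ m ih =>
      rw [pow_succ y, pow_succ' x, mul_assoc, ← mul_assoc y, hyx, ← mul_assoc,
        pow_mul_aeval_eq_aeval_mul_pow_of_twist σ⁻¹ hy, mul_assoc, ih, ← map_mul, hs_succ,
        mul_comm]
  have hz (m : ℕ) : z ^ m = aeval z (X ^ m : 𝕂[X]) := by simp
  congr 1
  · rw [mul_assoc, ← mul_assoc (z ^ k), ← pow_add, ← mul_assoc, hz,
      pow_mul_aeval_eq_aeval_mul_pow_of_twist σ hx, mul_assoc, hxn, ← map_mul, ← map_pow,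
      ← map_mul, ← map_pow, ← map_mul, ← map_mul, mul_comm]
  · rw [mul_assoc, ← mul_assoc (y ^ n), hyn, hz, hz, hz, ← map_mul, ← map_mul, ← map_mul]
    congr 1
    ring
end

section
/- Let 𝕂 be a field of characteristic zero, let p ∈ 𝕂[z] be a nonzero polynomial with root 0 of multiplicity k (so p(z) = z^k p̃(z) with p̃(0) ≠ 0), let q_+, q_- ∈ 𝕂 be nonzero and set q = q_+ q_-. Then the k-th Veronese subalgebra A(p;q_±)^{(k)} of A(p;q_±) is a strongly ℤ-graded algebra, and its degree-zero component is isomorphic as a 𝕂-algebra to the generalized Weyl algebra B(p;q,0), via an isomorphism sending the generators x, y, z of B(p;q,0) to x_- z_+^k, z_-^k x_+ and z_+ z_- respectively. -/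
set_option synthInstance.maxHeartbeats 1000000
set_option maxHeartbeats 1000000

open Polynomial FreeAlgebra

noncomputable section

variable (𝕂 : Type) [Field 𝕂]

/-- The defining relations of the algebra `A(p;q±)`: generator `0` is `z₊`, `1` is `z₋`,
`2` is `x₊`, `3` is `x₋`; `pt` is the polynomial `p̃` with `p(z) = z^k p̃(z)`. -/
inductive ARel (pt : Polynomial 𝕂) (qp qm : 𝕂) :
    FreeAlgebra 𝕂 (Fin 4) → FreeAlgebra 𝕂 (Fin 4) → Prop
  | comm : ARel pt qp qm (ι 𝕂 0 * ι 𝕂 1) (ι 𝕂 1 * ι 𝕂 0)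
  | pm : ARel pt qp qm (ι 𝕂 2 * ι 𝕂 3) (aeval (ι 𝕂 0 * ι 𝕂 1) pt)
  | mp : ARel pt qp qm (ι 𝕂 3 * ι 𝕂 2) (aeval ((qp * qm) • (ι 𝕂 0 * ι 𝕂 1)) pt)
  | pzp : ARel pt qp qm (ι 𝕂 2 * ι 𝕂 0) (qp⁻¹ • (ι 𝕂 0 * ι 𝕂 2))
  | pzm : ARel pt qp qm (ι 𝕂 2 * ι 𝕂 1) (qm⁻¹ • (ι 𝕂 1 * ι 𝕂 2))
  | mzp : ARel pt qp qm (ι 𝕂 3 * ι 𝕂 0) (qp • (ι 𝕂 0 * ι 𝕂 3))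
  | mzm : ARel pt qp qm (ι 𝕂 3 * ι 𝕂 1) (qm • (ι 𝕂 1 * ι 𝕂 3))

/-- The algebra `A(p;q±)`, presented by generators and relations. -/
abbrev APM (pt : Polynomial 𝕂) (qp qm : 𝕂) : Type := RingQuot (ARel 𝕂 pt qp qm)

variable {𝕂}

/-- The generators of `A(p;q±)`: `gen 0 = z₊`, `gen 1 = z₋`, `gen 2 = x₊`, `gen 3 = x₋`. -/
def gen (pt : Polynomial 𝕂) (qp qm : 𝕂) (i : Fin 4) : APM 𝕂 pt qp qm :=
  RingQuot.mkAlgHom 𝕂 (ARel 𝕂 pt qp qm) (ι 𝕂 i)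

/-- The degrees of the generators: `deg z₊ = 1`, `deg z₋ = -1`, `deg x₊ = k`, `deg x₋ = -k`. -/
def gdeg (k : ℕ) : Fin 4 → ℤ := ![1, -1, (k : ℤ), -(k : ℤ)]

/-- The degree-`n` component of the ℤ-grading of `A(p;q±)`: the span of the images of the
monomials in the generators of total degree `n`. -/
def acomp (pt : Polynomial 𝕂) (qp qm : 𝕂) (k : ℕ) (n : ℤ) : Submodule 𝕂 (APM 𝕂 pt qp qm) :=
  Submodule.span 𝕂
    {a | ∃ l : List (Fin 4), (l.map (gdeg k)).sum = n ∧ a = (l.map (gen pt qp qm)).prod}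


theorem acomp_one_mem (pt : Polynomial 𝕂) (qp qm : 𝕂) (k : ℕ) :
    (1 : APM 𝕂 pt qp qm) ∈ acomp pt qp qm k 0 :=
  Submodule.subset_span ⟨[], by simp, by simp⟩

theorem acomp_mul_le (pt : Polynomial 𝕂) (qp qm : 𝕂) (k : ℕ) (m n : ℤ) :
    acomp pt qp qm k m * acomp pt qp qm k n ≤ acomp pt qp qm k (m + n) := by
  rw [acomp, acomp, Submodule.span_mul_span]
  apply Submodule.span_mono
  rw [Set.mul_subset_iff]
  rintro _ ⟨l1, h1, rfl⟩ _ ⟨l2, h2, rfl⟩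
  exact ⟨l1 ++ l2, by simp [h1, h2], by simp⟩

/-- The degree-zero part of the `k`-th Veronese subalgebra of `A(p;q±)`
(equivalently, the degree-zero part of `A(p;q±)`), as a subalgebra. -/
def A0 (pt : Polynomial 𝕂) (qp qm : 𝕂) (k : ℕ) : Subalgebra 𝕂 (APM 𝕂 pt qp qm) where
  carrier := acomp pt qp qm k 0
  mul_mem' := fun ha hb => by
    simpa using acomp_mul_le pt qp qm k 0 0 (Submodule.mul_mem_mul ha hb)
  one_mem' := acomp_one_mem pt qp qm k
  add_mem' := fun ha hb => add_mem ha hb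
  zero_mem' := zero_mem _
  algebraMap_mem' := fun c => by
    rw [Algebra.algebraMap_eq_smul_one]
    exact Submodule.smul_mem _ _ (acomp_one_mem pt qp qm k)

/-- The degree-`n` component of the `k`-th Veronese subalgebra of `A(p;q±)`, viewed as a
left module over the degree-zero part `A0`. -/
def VN (pt : Polynomial 𝕂) (qp qm : 𝕂) (k : ℕ) (n : ℤ) :
    Submodule (A0 pt qp qm k) (APM 𝕂 pt qp qm) where
  carrier := acomp pt qp qm k (n * k)
  add_mem' := fun ha hb => add_mem ha hb
  zero_mem' := zero_mem _
  smul_mem' := fun c x hx => by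
    show (c : APM 𝕂 pt qp qm) * x ∈ _
    simpa using acomp_mul_le pt qp qm k 0 (n * k) (Submodule.mul_mem_mul c.2 hx)

variable (𝕂)

/-- The defining relations of the generalized Weyl algebra `B(p;q,0)`:
generator `0` is `x`, `1` is `y`, `2` is `z`. -/
inductive BRel (p : Polynomial 𝕂) (q : 𝕂) :
    FreeAlgebra 𝕂 (Fin 3) → FreeAlgebra 𝕂 (Fin 3) → Prop
  | xy : BRel p q (ι 𝕂 0 * ι 𝕂 1) (aeval (q • ι 𝕂 2) p)
  | yx : BRel p q (ι 𝕂 1 * ι 𝕂 0) (aeval (ι 𝕂 2) p)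
  | xz : BRel p q (ι 𝕂 0 * ι 𝕂 2) (q • (ι 𝕂 2 * ι 𝕂 0))
  | yz : BRel p q (ι 𝕂 1 * ι 𝕂 2) (q⁻¹ • (ι 𝕂 2 * ι 𝕂 1))

/-- The generalized Weyl algebra `B(p;q,0)`, presented by generators and relations. -/
abbrev GWA (p : Polynomial 𝕂) (q : 𝕂) : Type := RingQuot (BRel 𝕂 p q)

variable {𝕂}

/-- The generators of `B(p;q,0)`: `bgen 0 = x`, `bgen 1 = y`, `bgen 2 = z`. -/
def bgen (p : Polynomial 𝕂) (q : 𝕂) (i : Fin 3) : GWA 𝕂 p q :=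
  RingQuot.mkAlgHom 𝕂 (BRel 𝕂 p q) (ι 𝕂 i)

section Abstract

variable {A : Type*} [Ring A] [Algebra 𝕂 A]

theorem mul_pow_of_qcomm {x z : A} {s : 𝕂} (h : x * z = s • (z * x)) (n : ℕ) :
    x * z ^ n = s ^ n • (z ^ n * x) := by
  induction n with
  | zero => simp
  | succ n ih =>
    rw [pow_succ, ← mul_assoc, ih, smul_mul_assoc, mul_assoc, h, mul_smul_comm, smul_smul,
      ← mul_assoc, pow_succ]

theorem mul_mul_of_qcomm {x z w : A} {s t : 𝕂} (hz : x * z = s • (z * x))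
    (hw : x * w = t • (w * x)) : x * (z * w) = (s * t) • (z * w * x) := by
  rw [← mul_assoc, hz, smul_mul_assoc, mul_assoc, hw, mul_smul_comm, smul_smul, mul_assoc]

theorem mul_aeval_of_qcomm {x z : A} {s : 𝕂} (h : x * z = s • (z * x)) (f : 𝕂[X]) :
    x * aeval z f = aeval (s • z) f * x := by
  induction f using Polynomial.induction_on' with
  | add f g hf hg => simp only [map_add, mul_add, add_mul, hf, hg]
  | monomial n a =>
    simp only [aeval_monomial, ← Algebra.smul_def, _root_.smul_pow, mul_smul_comm, smul_mul_assoc,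
      mul_pow_of_qcomm h]
    exact smul_comm _ _ _

theorem commute_aeval {x z : A} (h : Commute x z) (f : 𝕂[X]) : Commute x (aeval z f) := by
  simpa [commute_iff_eq] using mul_aeval_of_qcomm (s := (1 : 𝕂)) (x := x) (z := z)
    (by rw [one_smul, h.eq]) f

theorem aeval_smul_eq (z : A) (s : 𝕂) (f : 𝕂[X]) :
    aeval (s • z) f = aeval z (f.comp (C s * X)) := by
  simp [aeval_comp, Algebra.smul_def]

theorem pow_mul_pow_mem (S : Subalgebra 𝕂 A) {x z : A} {s : 𝕂} (hs : s ≠ 0)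
    (h : x * z = s • (z * x)) {k : ℕ} (hS : z ^ k * x ∈ S) (c : ℕ) :
    z ^ (k * c) * x ^ c ∈ S := by
  induction c with
  | zero => simp
  | succ c ih =>
    have key : z ^ (k * c) * x = (s ^ (k * c))⁻¹ • (x * z ^ (k * c)) := by
      rw [mul_pow_of_qcomm h, inv_smul_smul₀ (pow_ne_zero _ hs)]
    have : z ^ (k * (c + 1)) * x ^ (c + 1)
        = (s ^ (k * c))⁻¹ • ((z ^ k * x) * (z ^ (k * c) * x ^ c)) := by
      rw [mul_add, mul_one, add_comm (k * c), pow_add, pow_succ', mul_assoc,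
        ← mul_assoc _ x, key]
      simp only [smul_mul_assoc, mul_smul_comm, mul_assoc]
    rw [this]
    exact S.smul_mem (S.mul_mem hS ih) _

/-- The `c`-th power of `a` for `c ≥ 0`, the `(-c)`-th power of `b` for `c < 0`. -/
def biPow (a b : A) (c : ℤ) : A := if 0 ≤ c then a ^ c.toNat else b ^ (-c).toNat

theorem biPow_natCast (a b : A) (n : ℕ) : biPow a b n = a ^ n := by simp [biPow]

theorem biPow_neg_natCast (a b : A) (n : ℕ) : biPow a b (-(n : ℤ)) = b ^ n := by
  rcases n with _ | n
  · simp [biPow]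
  · rw [biPow, if_neg (by omega)]
    simp

theorem biPow_swap (a b : A) (c : ℤ) : biPow b a (-c) = biPow a b c := by
  obtain ⟨n, rfl | rfl⟩ := c.eq_nat_or_neg
  · rw [biPow_neg_natCast, biPow_natCast]
  · rw [neg_neg, biPow_neg_natCast, biPow_natCast]

theorem exists_mul_biPow_succ {a b u : A} {f : 𝕂[X]} (h : a * b = aeval u f) (c : ℤ) :
    ∃ P : 𝕂[X], a * biPow a b c = aeval u P * biPow a b (c + 1) := by
  obtain ⟨n, rfl | rfl⟩ := c.eq_nat_or_neg
  · refine ⟨1, ?_⟩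
    rw [show (n : ℤ) + 1 = ((n + 1 : ℕ) : ℤ) by simp, biPow_natCast, biPow_natCast, pow_succ']
    simp
  · rcases n with _ | n
    · exact ⟨1, by simp [biPow]⟩
    · refine ⟨f, ?_⟩
      rw [show -((n + 1 : ℕ) : ℤ) + 1 = -(n : ℤ) by push_cast; ring, biPow_neg_natCast,
        biPow_neg_natCast, pow_succ', ← mul_assoc, h]

theorem exists_mul_biPow_pred {a b u : A} {f : 𝕂[X]} (h : b * a = aeval u f) (c : ℤ) :
    ∃ P : 𝕂[X], b * biPow a b c = aeval u P * biPow a b (c - 1) := by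
  obtain ⟨P, hP⟩ := exists_mul_biPow_succ h (-c)
  refine ⟨P, ?_⟩
  rwa [biPow_swap, show -c + 1 = -(c - 1) by ring, biPow_swap] at hP

end Abstract

section WeightedShift

/-- The weighted shift `v ↦ (n ↦ s n * v (n + d))` on sequences of polynomials. -/
def wshift (s : ℤ → 𝕂[X]) (d : ℤ) : Module.End 𝕂 (ℤ → 𝕂[X]) where
  toFun v n := s n * v (n + d)
  map_add' v w := by ext1 n; simp [mul_add]
  map_smul' c v := by ext1 n; simp

theorem wshift_apply (s : ℤ → 𝕂[X]) (d : ℤ) (v : ℤ → 𝕂[X]) (n : ℤ) :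
    wshift s d v n = s n * v (n + d) := rfl

theorem wshift_mul (s t : ℤ → 𝕂[X]) (d e : ℤ) :
    wshift s d * wshift t e = wshift (fun n => s n * t (n + d)) (d + e) := by
  ext1 v; ext1 n
  simp only [Module.End.mul_apply, wshift_apply, mul_assoc, add_assoc]

theorem smul_wshift (c : 𝕂) (s : ℤ → 𝕂[X]) (d : ℤ) :
    c • wshift s d = wshift (fun n => C c * s n) d := by
  ext1 v; ext1 n
  simp only [LinearMap.smul_apply, Pi.smul_apply, wshift_apply, smul_eq_C_mul, mul_assoc]

theorem aeval_wshift (s : ℤ → 𝕂[X]) (f : 𝕂[X]) :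
    aeval (wshift s 0) f = wshift (fun n => f.comp (s n)) 0 := by
  induction f using Polynomial.induction_on' with
  | add f g hf hg =>
    rw [map_add, hf, hg]
    ext1 v; ext1 n
    simp [wshift_apply, add_mul]
  | monomial m a =>
    have hpow : wshift s 0 ^ m = wshift (fun n => s n ^ m) 0 := by
      induction m with
      | zero => ext1 v; ext1 n; simp [wshift_apply]
      | succ m ih => rw [pow_succ, ih, wshift_mul]; simp [pow_succ]
    rw [aeval_monomial, ← Algebra.smul_def, hpow, smul_wshift]
    simp [monomial_comp]

/-- `E` sends nonzero sequences supported at `n` to nonzero ones supported at `n + d`. -/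
def ShiftsSingle (E : Module.End 𝕂 (ℤ → 𝕂[X])) (d : ℤ) : Prop :=
  ∀ (n : ℤ) (h : 𝕂[X]), h ≠ 0 →
    ∃ h' : 𝕂[X], h' ≠ 0 ∧ E (Pi.single n h) = Pi.single (n + d) h'

theorem ShiftsSingle.mul {E F : Module.End 𝕂 (ℤ → 𝕂[X])} {d e : ℤ}
    (hE : ShiftsSingle E d) (hF : ShiftsSingle F e) : ShiftsSingle (E * F) (d + e) := by
  intro n h hh
  obtain ⟨h₁, hh₁, e₁⟩ := hF n h hh
  obtain ⟨h₂, hh₂, e₂⟩ := hE (n + e) h₁ hh₁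
  exact ⟨h₂, hh₂, by rw [Module.End.mul_apply, e₁, e₂, add_assoc, add_comm e]⟩

theorem ShiftsSingle.pow {E : Module.End 𝕂 (ℤ → 𝕂[X])} {d : ℤ} (hE : ShiftsSingle E d) (m : ℕ) :
    ShiftsSingle (E ^ m) (m * d) := by
  induction m with
  | zero => exact fun n h hh => ⟨h, hh, by simp⟩
  | succ m ih => simpa [pow_succ, add_mul] using ih.mul hE

theorem shiftsSingle_wshift {s : ℤ → 𝕂[X]} (hs : ∀ n, s n ≠ 0) {d e : ℤ} (hde : d + e = 0) :
    ShiftsSingle (wshift s d) e := by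
  intro n h hh
  refine ⟨s (n + e) * h, mul_ne_zero (hs _) hh, ?_⟩
  ext1 m
  rw [wshift_apply]
  by_cases hm : m = n + e
  · subst hm
    rw [show n + e + d = n by linarith, Pi.single_eq_same, Pi.single_eq_same]
  · rw [Pi.single_eq_of_ne hm, Pi.single_eq_of_ne (by omega), mul_zero]

end WeightedShift

section APMRelations

variable (pt : 𝕂[X]) (qp qm : 𝕂)

local notation "zp" => gen pt qp qm 0
local notation "zm" => gen pt qp qm 1
local notation "xp" => gen pt qp qm 2
local notation "xm" => gen pt qp qm 3

theorem gen_zp_mul_zm : zp * zm = zm * zp := by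
  simpa [gen] using RingQuot.mkAlgHom_rel 𝕂 (ARel.comm (pt := pt) (qp := qp) (qm := qm))

theorem gen_xp_mul_xm : xp * xm = aeval (zp * zm) pt := by
  simpa [gen, ← aeval_algHom_apply] using
    RingQuot.mkAlgHom_rel 𝕂 (ARel.pm (pt := pt) (qp := qp) (qm := qm))

theorem gen_xm_mul_xp : xm * xp = aeval ((qp * qm) • (zp * zm)) pt := by
  simpa only [gen, ← aeval_algHom_apply, map_mul, map_smul] using
    RingQuot.mkAlgHom_rel 𝕂 (ARel.mp (pt := pt) (qp := qp) (qm := qm))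

theorem gen_xp_mul_zp : xp * zp = qp⁻¹ • (zp * xp) := by
  simpa [gen] using RingQuot.mkAlgHom_rel 𝕂 (ARel.pzp (pt := pt) (qp := qp) (qm := qm))

theorem gen_xp_mul_zm : xp * zm = qm⁻¹ • (zm * xp) := by
  simpa [gen] using RingQuot.mkAlgHom_rel 𝕂 (ARel.pzm (pt := pt) (qp := qp) (qm := qm))

theorem gen_xm_mul_zp : xm * zp = qp • (zp * xm) := by
  simpa [gen] using RingQuot.mkAlgHom_rel 𝕂 (ARel.mzp (pt := pt) (qp := qp) (qm := qm))

theorem gen_xm_mul_zm : xm * zm = qm • (zm * xm) := by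
  simpa [gen] using RingQuot.mkAlgHom_rel 𝕂 (ARel.mzm (pt := pt) (qp := qp) (qm := qm))

theorem gen_xp_mul_zp_mul_zm : xp * (zp * zm) = (qp * qm)⁻¹ • (zp * zm * xp) := by
  rw [mul_inv]
  exact mul_mul_of_qcomm (gen_xp_mul_zp pt qp qm) (gen_xp_mul_zm pt qp qm)

theorem gen_xm_mul_zp_mul_zm : xm * (zp * zm) = (qp * qm) • (zp * zm * xm) :=
  mul_mul_of_qcomm (gen_xm_mul_zp pt qp qm) (gen_xm_mul_zm pt qp qm)

theorem gen_zp_mul_zm_pow (n : ℕ) : (zp * zm) ^ n = zp ^ n * zm ^ n :=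
  Commute.mul_pow (gen_zp_mul_zm pt qp qm) n

end APMRelations

section Grading

variable (pt : 𝕂[X]) (qp qm : 𝕂) (k : ℕ)

theorem gen_mem_acomp (i : Fin 4) : gen pt qp qm i ∈ acomp pt qp qm k (gdeg k i) :=
  Submodule.subset_span ⟨[i], by simp, by simp⟩

theorem mul_mem_acomp {a b : APM 𝕂 pt qp qm} {m n l : ℤ} (ha : a ∈ acomp pt qp qm k m)
    (hb : b ∈ acomp pt qp qm k n) (h : m + n = l) : a * b ∈ acomp pt qp qm k l :=
  h ▸ acomp_mul_le pt qp qm k m n (Submodule.mul_mem_mul ha hb)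

theorem pow_mem_acomp {a : APM 𝕂 pt qp qm} {m : ℤ} (ha : a ∈ acomp pt qp qm k m) (n : ℕ) :
    a ^ n ∈ acomp pt qp qm k (n * m) := by
  induction n with
  | zero => simpa using acomp_one_mem pt qp qm k
  | succ n ih => exact pow_succ a n ▸ mul_mem_acomp pt qp qm k ih ha (by push_cast; ring)

theorem zp_mul_zm_mem_acomp : gen pt qp qm 0 * gen pt qp qm 1 ∈ acomp pt qp qm k 0 :=
  mul_mem_acomp pt qp qm k (gen_mem_acomp pt qp qm k 0) (gen_mem_acomp pt qp qm k 1)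
    (by simp [gdeg])

theorem zp_pow_mem_acomp : gen pt qp qm 0 ^ k ∈ acomp pt qp qm k k := by
  simpa [gdeg] using pow_mem_acomp pt qp qm k (gen_mem_acomp pt qp qm k 0) k

theorem zm_pow_mem_acomp : gen pt qp qm 1 ^ k ∈ acomp pt qp qm k (-k) := by
  simpa [gdeg] using pow_mem_acomp pt qp qm k (gen_mem_acomp pt qp qm k 1) k

theorem xp_mem_acomp : gen pt qp qm 2 ∈ acomp pt qp qm k k := by
  simpa [gdeg] using gen_mem_acomp pt qp qm k 2

theorem xm_mem_acomp : gen pt qp qm 3 ∈ acomp pt qp qm k (-k) := by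
  simpa [gdeg] using gen_mem_acomp pt qp qm k 3

theorem aeval_mem_acomp_zero {a : APM 𝕂 pt qp qm} (ha : a ∈ acomp pt qp qm k 0) (f : 𝕂[X]) :
    aeval a f ∈ acomp pt qp qm k 0 :=
  Algebra.adjoin_singleton_le (S := A0 pt qp qm k) ha (aeval_mem_adjoin_singleton 𝕂 a)

theorem one_mem_mul_of_isCoprime {f g : 𝕂[X]} (h : IsCoprime f g) {m : ℤ}
    {u a b c d : APM 𝕂 pt qp qm} (hu : u ∈ acomp pt qp qm k 0)
    (ha : a ∈ acomp pt qp qm k m) (hb : b ∈ acomp pt qp qm k (-m))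
    (hc : c ∈ acomp pt qp qm k m) (hd : d ∈ acomp pt qp qm k (-m))
    (hf : a * b = aeval u f) (hg : c * d = aeval u g) :
    (1 : APM 𝕂 pt qp qm) ∈ acomp pt qp qm k m * acomp pt qp qm k (-m) := by
  obtain ⟨r, s, hrs⟩ := h
  have h1 : (1 : APM 𝕂 pt qp qm) = aeval u r * a * b + aeval u s * c * d := by
    rw [mul_assoc, mul_assoc, hf, hg, ← map_mul, ← map_mul, ← map_add, hrs, map_one]
  rw [h1]
  exact add_mem
    (Submodule.mul_mem_mul
      (mul_mem_acomp pt qp qm k (aeval_mem_acomp_zero pt qp qm k hu r) ha (zero_add _)) hb)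
    (Submodule.mul_mem_mul
      (mul_mem_acomp pt qp qm k (aeval_mem_acomp_zero pt qp qm k hu s) hc (zero_add _)) hd)

variable {pt qp qm}

theorem isCoprime_X_pow_of_eval_ne_zero {f : 𝕂[X]} (hf : f.eval 0 ≠ 0) :
    IsCoprime f (X ^ k) := by
  refine IsCoprime.pow_right (IsCoprime.symm ?_)
  rw [(Polynomial.irreducible_X).coprime_iff_not_dvd, X_dvd_iff, coeff_zero_eq_eval_zero]
  exact hf

theorem one_mem_acomp_mul_acomp_neg (hpt0 : pt.eval 0 ≠ 0) :
    (1 : APM 𝕂 pt qp qm) ∈ acomp pt qp qm k k * acomp pt qp qm k (-k) :=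
  one_mem_mul_of_isCoprime pt qp qm k (isCoprime_X_pow_of_eval_ne_zero k hpt0)
    (zp_mul_zm_mem_acomp pt qp qm k) (xp_mem_acomp pt qp qm k) (xm_mem_acomp pt qp qm k)
    (zp_pow_mem_acomp pt qp qm k) (zm_pow_mem_acomp pt qp qm k) (gen_xp_mul_xm pt qp qm)
    (by simp [gen_zp_mul_zm_pow])

theorem one_mem_acomp_neg_mul_acomp (hpt0 : pt.eval 0 ≠ 0) :
    (1 : APM 𝕂 pt qp qm) ∈ acomp pt qp qm k (-k) * acomp pt qp qm k k := by
  have := one_mem_mul_of_isCoprime pt qp qm k (m := -k)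
    (isCoprime_X_pow_of_eval_ne_zero k (f := pt.comp (C (qp * qm) * X)) (by simpa using hpt0))
    (zp_mul_zm_mem_acomp pt qp qm k) (xm_mem_acomp pt qp qm k)
    (by simpa using xp_mem_acomp pt qp qm k) (zm_pow_mem_acomp pt qp qm k)
    (by simpa using zp_pow_mem_acomp pt qp qm k)
    (by rw [gen_xm_mul_xp, aeval_smul_eq])
    (by rw [map_pow, aeval_X, gen_zp_mul_zm_pow]
        exact Commute.pow_pow (gen_zp_mul_zm pt qp qm).symm k k)
  simpa using this

theorem one_mem_acomp_mul_neg {d : ℤ}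
    (hd : (1 : APM 𝕂 pt qp qm) ∈ acomp pt qp qm k d * acomp pt qp qm k (-d)) (n : ℕ) :
    (1 : APM 𝕂 pt qp qm) ∈ acomp pt qp qm k (n * d) * acomp pt qp qm k (-(n * d)) := by
  induction n with
  | zero =>
    simpa using Submodule.mul_mem_mul (acomp_one_mem pt qp qm k) (acomp_one_mem pt qp qm k)
  | succ n ih =>
    have h1 : (1 : Submodule 𝕂 (APM 𝕂 pt qp qm)) ≤
        acomp pt qp qm k (n * d) * acomp pt qp qm k (-(n * d)) := Submodule.one_le.mpr ih
    have h2 : acomp pt qp qm k d * acomp pt qp qm k (-d) ≤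
        acomp pt qp qm k (((n + 1 : ℕ) : ℤ) * d) *
          acomp pt qp qm k (-(((n + 1 : ℕ) : ℤ) * d)) :=
      calc acomp pt qp qm k d * acomp pt qp qm k (-d)
          = acomp pt qp qm k d * 1 * acomp pt qp qm k (-d) := by rw [mul_one]
        _ ≤ acomp pt qp qm k d *
              (acomp pt qp qm k (n * d) * acomp pt qp qm k (-(n * d))) *
              acomp pt qp qm k (-d) := by gcongr
        _ = (acomp pt qp qm k d * acomp pt qp qm k (n * d)) *
              (acomp pt qp qm k (-(n * d)) * acomp pt qp qm k (-d)) := by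
            simp only [mul_assoc]
        _ ≤ _ := by
            refine mul_le_mul' ((acomp_mul_le pt qp qm k _ _).trans (le_of_eq ?_))
              ((acomp_mul_le pt qp qm k _ _).trans (le_of_eq ?_)) <;>
            · congr 1; push_cast; ring
    exact h2 hd

theorem acomp_mul_acomp_eq (hpt0 : pt.eval 0 ≠ 0) (m n : ℤ) :
    acomp pt qp qm k (m * k) * acomp pt qp qm k (n * k) = acomp pt qp qm k ((m + n) * k) := by
  refine le_antisymm ((acomp_mul_le pt qp qm k _ _).trans (by rw [add_mul])) ?_
  have h1 : (1 : Submodule 𝕂 (APM 𝕂 pt qp qm)) ≤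
      acomp pt qp qm k (m * k) * acomp pt qp qm k (-(m * k)) := by
    rw [Submodule.one_le]
    obtain ⟨j, rfl | rfl⟩ := m.eq_nat_or_neg
    · exact one_mem_acomp_mul_neg k (one_mem_acomp_mul_acomp_neg k hpt0) j
    · simpa using one_mem_acomp_mul_neg k (d := -k)
        (by simpa using one_mem_acomp_neg_mul_acomp k hpt0) j
  calc acomp pt qp qm k ((m + n) * k)
      = 1 * acomp pt qp qm k ((m + n) * k) := by rw [one_mul]
    _ ≤ acomp pt qp qm k (m * k) * acomp pt qp qm k (-(m * k)) *
          acomp pt qp qm k ((m + n) * k) := by gcongr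
    _ = acomp pt qp qm k (m * k) * (acomp pt qp qm k (-(m * k)) *
          acomp pt qp qm k ((m + n) * k)) := by rw [mul_assoc]
    _ ≤ _ := by
      refine mul_le_mul' le_rfl ((acomp_mul_le pt qp qm k _ _).trans (le_of_eq ?_))
      congr 1; ring

end Grading

section Lifts

variable {A : Type*} [Ring A] [Algebra 𝕂 A] {pt : 𝕂[X]} {qp qm : 𝕂}

theorem exists_algHom_APM (g : Fin 4 → A) (comm : g 0 * g 1 = g 1 * g 0)
    (pm : g 2 * g 3 = aeval (g 0 * g 1) pt)
    (mp : g 3 * g 2 = aeval ((qp * qm) • (g 0 * g 1)) pt)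
    (pzp : g 2 * g 0 = qp⁻¹ • (g 0 * g 2)) (pzm : g 2 * g 1 = qm⁻¹ • (g 1 * g 2))
    (mzp : g 3 * g 0 = qp • (g 0 * g 3)) (mzm : g 3 * g 1 = qm • (g 1 * g 3)) :
    ∃ ψ : APM 𝕂 pt qp qm →ₐ[𝕂] A, ∀ i, ψ (gen pt qp qm i) = g i := by
  refine ⟨RingQuot.liftAlgHom 𝕂 ⟨FreeAlgebra.lift 𝕂 g, fun a b h => ?_⟩, fun i => ?_⟩
  · cases h <;>
      simpa only [← aeval_algHom_apply, map_mul, map_smul, FreeAlgebra.lift_ι_apply]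
  · rw [gen, RingQuot.liftAlgHom_mkAlgHom_apply, FreeAlgebra.lift_ι_apply]

theorem exists_algHom_GWA {p : 𝕂[X]} {q : 𝕂} (g : Fin 3 → A)
    (xy : g 0 * g 1 = aeval (q • g 2) p) (yx : g 1 * g 0 = aeval (g 2) p)
    (xz : g 0 * g 2 = q • (g 2 * g 0)) (yz : g 1 * g 2 = q⁻¹ • (g 2 * g 1)) :
    ∃ φ : GWA 𝕂 p q →ₐ[𝕂] A, ∀ i, φ (bgen p q i) = g i := by
  refine ⟨RingQuot.liftAlgHom 𝕂 ⟨FreeAlgebra.lift 𝕂 g, fun a b h => ?_⟩, fun i => ?_⟩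
  · cases h <;>
      simpa only [← aeval_algHom_apply, map_mul, map_smul, FreeAlgebra.lift_ι_apply]
  · rw [bgen, RingQuot.liftAlgHom_mkAlgHom_apply, FreeAlgebra.lift_ι_apply]

end Lifts

section Independence

variable (pt : 𝕂[X]) (qp qm : 𝕂) (k : ℕ)

open AddMonoidAlgebra in
theorem exists_coaction : ∃ δ : APM 𝕂 pt qp qm →ₐ[𝕂] AddMonoidAlgebra (APM 𝕂 pt qp qm) ℤ,
    ∀ n, ∀ a ∈ acomp pt qp qm k n, δ a = single n a := by
  have haeval (c : 𝕂) (f : 𝕂[X]) :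
      aeval (c • single (0 : ℤ) (gen pt qp qm 0 * gen pt qp qm 1)) f =
        single (0 : ℤ) (aeval (c • (gen pt qp qm 0 * gen pt qp qm 1)) f) := by
    rw [smul_single]
    exact aeval_algHom_apply (singleZeroAlgHom : APM 𝕂 pt qp qm →ₐ[𝕂] _) _ f
  obtain ⟨δ, hδ⟩ := exists_algHom_APM (pt := pt) (qp := qp) (qm := qm)
    (fun i => single (gdeg k i) (gen pt qp qm i))
    (by simp only [gdeg, Matrix.cons_val, single_mul_single, gen_zp_mul_zm]; rfl)
    (by
      simp only [gdeg, Matrix.cons_val, single_mul_single, gen_xp_mul_xm, add_neg_cancel]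
      simpa only [one_smul] using (haeval 1 pt).symm)
    (by
      simp only [gdeg, Matrix.cons_val, single_mul_single, gen_xm_mul_xp, add_neg_cancel,
        neg_add_cancel]
      exact (haeval (qp * qm) pt).symm)
    (by
      simp only [gdeg, Matrix.cons_val, single_mul_single, smul_single, gen_xp_mul_zp, add_comm])
    (by
      simp only [gdeg, Matrix.cons_val, single_mul_single, smul_single, gen_xp_mul_zm, add_comm])
    (by
      simp only [gdeg, Matrix.cons_val, single_mul_single, smul_single, gen_xm_mul_zp, add_comm])
    (by
      simp only [gdeg, Matrix.cons_val, single_mul_single, smul_single, gen_xm_mul_zm, add_comm])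
  refine ⟨δ, fun n a ha => ?_⟩
  induction ha using Submodule.span_induction with
  | mem a ha =>
    obtain ⟨l, rfl, rfl⟩ := ha
    induction l with
    | nil => simp only [List.map_nil, List.prod_nil, List.sum_nil, map_one]; rfl
    | cons i l ih =>
      simp only [List.map_cons, List.prod_cons, List.sum_cons, map_mul, hδ, ih, single_mul_single]
  | zero => simp
  | add a b _ _ ha hb => rw [map_add, ha, hb, single_add]
  | smul c a _ ha => rw [map_smul, ha, smul_single]

theorem iSupIndep_acomp : iSupIndep (acomp pt qp qm k) := by
  obtain ⟨δ, hδ⟩ := exists_coaction pt qp qm k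
  intro n
  rw [Submodule.disjoint_def]
  intro a ha ha'
  let π : APM 𝕂 pt qp qm →ₗ[𝕂] APM 𝕂 pt qp qm :=
    { toFun := fun a => (δ a).coeff n
      map_add' := by simp
      map_smul' := by simp }
  have hker : ⨆ j, ⨆ (_ : j ≠ n), acomp pt qp qm k j ≤ LinearMap.ker π := by
    refine iSup₂_le fun j hj b hb => ?_
    simp [-LaurentPolynomial.single_eq_C_mul_T, π, hδ j b hb, hj]
  simpa [-LaurentPolynomial.single_eq_C_mul_T, π, hδ n a ha] using hker ha'

end Independence

section NormalForm

variable {pt : 𝕂[X]} {qp qm : 𝕂} {k : ℕ}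

local notation "zp" => gen pt qp qm 0
local notation "zm" => gen pt qp qm 1
local notation "xp" => gen pt qp qm 2
local notation "xm" => gen pt qp qm 3

variable (pt qp qm k) in
/-- The span of the normally ordered monomials `z₊^a z₋^b x₊^c` and `z₊^a z₋^b x₋^c` of
degree `n`. -/
def normalSpan (n : ℤ) : Submodule 𝕂 (APM 𝕂 pt qp qm) :=
  Submodule.span 𝕂 {w | ∃ (a b : ℕ) (c : ℤ), (a : ℤ) - b + k * c = n ∧
    w = zp ^ a * zm ^ b * biPow xp xm c}

theorem mem_normalSpan {a b : ℕ} {c n : ℤ} (h : (a : ℤ) - b + k * c = n) :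
    zp ^ a * zm ^ b * biPow xp xm c ∈ normalSpan pt qp qm k n :=
  Submodule.subset_span ⟨a, b, c, h, rfl⟩

theorem aeval_mul_biPow_mem_normalSpan (a b : ℕ) (P : 𝕂[X]) {c n : ℤ}
    (h : (a : ℤ) - b + k * c = n) :
    zp ^ a * zm ^ b * (aeval (zp * zm) P * biPow xp xm c) ∈ normalSpan pt qp qm k n := by
  induction P using Polynomial.induction_on' with
  | add f g hf hg => simpa only [map_add, add_mul, mul_add] using add_mem hf hg
  | monomial i r =>
    rw [aeval_monomial, ← Algebra.smul_def, smul_mul_assoc, mul_smul_comm, gen_zp_mul_zm_pow]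
    refine Submodule.smul_mem _ _ ?_
    have hcomm : zm ^ b * zp ^ i = zp ^ i * zm ^ b :=
      Commute.pow_pow (gen_zp_mul_zm pt qp qm).symm b i
    have : zp ^ a * zm ^ b * (zp ^ i * zm ^ i * biPow xp xm c)
        = zp ^ (a + i) * zm ^ (b + i) * biPow xp xm c := by
      simp only [pow_add, mul_assoc]
      rw [← mul_assoc (zm ^ b), hcomm, mul_assoc]
    rw [this]
    exact mem_normalSpan (by push_cast; linarith)

theorem gen_mul_mem_normalSpan (i : Fin 4) {n : ℤ} {w : APM 𝕂 pt qp qm}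
    (hw : w ∈ normalSpan pt qp qm k n) :
    gen pt qp qm i * w ∈ normalSpan pt qp qm k (gdeg k i + n) := by
  induction hw using Submodule.span_induction with
  | zero => simp
  | add a b _ _ ha hb => rw [mul_add]; exact add_mem ha hb
  | smul c a _ ha => rw [mul_smul_comm]; exact Submodule.smul_mem _ _ ha
  | mem w hw =>
    obtain ⟨a, b, c, rfl, rfl⟩ := hw
    fin_cases i
    · rw [← mul_assoc, ← mul_assoc]
      simp only [Fin.zero_eta]
      rw [← pow_succ']
      exact mem_normalSpan (by simp [gdeg]; ring)
    · have hcomm : zm * zp ^ a = zp ^ a * zm := Commute.pow_right (gen_zp_mul_zm pt qp qm).symm a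
      simp only [Fin.mk_one]
      rw [← mul_assoc, ← mul_assoc, hcomm, mul_assoc _ zm, ← pow_succ']
      exact mem_normalSpan (by simp [gdeg]; ring)
    · obtain ⟨P, hP⟩ := exists_mul_biPow_succ (gen_xp_mul_xm pt qp qm) c
      simp only [Fin.reduceFinMk]
      rw [← mul_assoc, mul_mul_of_qcomm (mul_pow_of_qcomm (gen_xp_mul_zp pt qp qm) a)
        (mul_pow_of_qcomm (gen_xp_mul_zm pt qp qm) b), smul_mul_assoc, mul_assoc _ xp, hP]
      exact Submodule.smul_mem _ _
        (aeval_mul_biPow_mem_normalSpan a b P (by simp [gdeg]; ring))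
    · obtain ⟨P, hP⟩ := exists_mul_biPow_pred
        ((gen_xm_mul_xp pt qp qm).trans (aeval_smul_eq _ _ _)) c
      simp only [Fin.reduceFinMk]
      rw [← mul_assoc, mul_mul_of_qcomm (mul_pow_of_qcomm (gen_xm_mul_zp pt qp qm) a)
        (mul_pow_of_qcomm (gen_xm_mul_zm pt qp qm) b), smul_mul_assoc, mul_assoc _ xm, hP]
      exact Submodule.smul_mem _ _
        (aeval_mul_biPow_mem_normalSpan a b P (by simp [gdeg]; ring))

theorem acomp_le_normalSpan (n : ℤ) : acomp pt qp qm k n ≤ normalSpan pt qp qm k n := by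
  refine Submodule.span_le.mpr ?_
  rintro _ ⟨l, rfl, rfl⟩
  induction l with
  | nil => exact Submodule.subset_span ⟨0, 0, 0, by simp, by simp [biPow]⟩
  | cons i l ih => simpa using gen_mul_mem_normalSpan i ih

theorem acomp_zero_le_subalgebra (hqp : qp ≠ 0) (hqm : qm ≠ 0) (S : Subalgebra 𝕂 (APM 𝕂 pt qp qm))
    (hx : xm * zp ^ k ∈ S) (hy : zm ^ k * xp ∈ S) (hz : zp * zm ∈ S) :
    acomp pt qp qm k 0 ≤ Subalgebra.toSubmodule S := by
  have hx' : zp ^ k * xm ∈ S := by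
    have : zp ^ k * xm = (qp ^ k)⁻¹ • (xm * zp ^ k) := by
      rw [mul_pow_of_qcomm (gen_xm_mul_zp pt qp qm), inv_smul_smul₀ (pow_ne_zero _ hqp)]
    exact this ▸ S.smul_mem hx _
  refine (acomp_le_normalSpan 0).trans (Submodule.span_le.mpr ?_)
  rintro _ ⟨a, b, c, h, rfl⟩
  rw [SetLike.mem_coe, Subalgebra.mem_toSubmodule]
  obtain ⟨m, rfl | rfl⟩ := c.eq_nat_or_neg
  · obtain rfl : b = a + k * m := by zify; linarith
    rw [biPow_natCast, pow_add, ← mul_assoc, ← gen_zp_mul_zm_pow, mul_assoc]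
    exact S.mul_mem (S.pow_mem hz _)
      (pow_mul_pow_mem S (inv_ne_zero hqm) (gen_xp_mul_zm pt qp qm) hy m)
  · obtain rfl : a = b + k * m := by zify; linarith
    have hcomm : zp ^ (k * m) * zm ^ b = zm ^ b * zp ^ (k * m) :=
      Commute.pow_pow (gen_zp_mul_zm pt qp qm) _ _
    rw [biPow_neg_natCast, pow_add, mul_assoc _ (zp ^ (k * m)), hcomm, ← mul_assoc,
      ← gen_zp_mul_zm_pow, mul_assoc]
    exact S.mul_mem (S.pow_mem hz _)
      (pow_mul_pow_mem S hqp (gen_xm_mul_zp pt qp qm) hx' m)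

end NormalForm

section GWANormalForm

variable {p : 𝕂[X]} {q : 𝕂}

local notation "x" => bgen p q 0
local notation "y" => bgen p q 1
local notation "z" => bgen p q 2

theorem bgen_x_mul_y : x * y = aeval (q • z) p := by
  simpa only [bgen, ← aeval_algHom_apply, map_mul, map_smul] using
    RingQuot.mkAlgHom_rel 𝕂 (BRel.xy (p := p) (q := q))

theorem bgen_y_mul_x : y * x = aeval z p := by
  simpa only [bgen, ← aeval_algHom_apply, map_mul, map_smul] using
    RingQuot.mkAlgHom_rel 𝕂 (BRel.yx (p := p) (q := q))

theorem bgen_x_mul_z : x * z = q • (z * x) := by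
  simpa only [bgen, map_mul, map_smul] using
    RingQuot.mkAlgHom_rel 𝕂 (BRel.xz (p := p) (q := q))

theorem bgen_y_mul_z : y * z = q⁻¹ • (z * y) := by
  simpa only [bgen, map_mul, map_smul] using
    RingQuot.mkAlgHom_rel 𝕂 (BRel.yz (p := p) (q := q))

theorem GWA_induction {P : GWA 𝕂 p q → Prop} (one : P 1)
    (bgen_mul : ∀ i b, P b → P (bgen p q i * b)) (add : ∀ a b, P a → P b → P (a + b))
    (smul : ∀ (c : 𝕂) b, P b → P (c • b)) (b : GWA 𝕂 p q) : P b := by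
  obtain ⟨f, rfl⟩ := RingQuot.mkAlgHom_surjective 𝕂 (BRel 𝕂 p q) b
  suffices ∀ b, P b → P (RingQuot.mkAlgHom 𝕂 (BRel 𝕂 p q) f * b) by simpa using this 1 one
  induction f using FreeAlgebra.induction with
  | grade0 r =>
    intro b hb
    rw [AlgHom.commutes, ← Algebra.smul_def]
    exact smul r b hb
  | grade1 i => exact bgen_mul i
  | mul f g hf hg =>
    intro b hb
    rw [map_mul, mul_assoc]
    exact hf _ (hg _ hb)
  | add f g hf hg =>
    intro b hb
    rw [map_add, add_mul]
    exact add _ _ (hf _ hb) (hg _ hb)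

variable (p q) in
/-- The `𝕂`-linear map sending a family of polynomials `f_c` to the sum of all `f_c(z) y^c`
with `c ≥ 0` and `f_c(z) x^{-c}` with `c < 0`. -/
def normalMap : (ℤ →₀ 𝕂[X]) →ₗ[𝕂] GWA 𝕂 p q :=
  Finsupp.lsum 𝕂 fun c => LinearMap.mulRight 𝕂 (biPow y x c) ∘ₗ (aeval z).toLinearMap

theorem normalMap_single (c : ℤ) (f : 𝕂[X]) :
    normalMap p q (Finsupp.single c f) = aeval z f * biPow y x c := by
  simp [normalMap]

theorem bgen_mul_normalMap_mem (i : Fin 3) (f : ℤ →₀ 𝕂[X]) :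
    bgen p q i * normalMap p q f ∈ LinearMap.range (normalMap p q) := by
  induction f using Finsupp.induction_linear with
  | zero => simp
  | add f g hf hg => rw [map_add, mul_add]; exact add_mem hf hg
  | single c f =>
    rw [normalMap_single, ← mul_assoc]
    fin_cases i
    · obtain ⟨P, hP⟩ := exists_mul_biPow_pred
        ((bgen_x_mul_y (p := p) (q := q)).trans (aeval_smul_eq _ _ _)) c
      refine ⟨Finsupp.single (c - 1) (f.comp (C q * X) * P), ?_⟩
      simp only [Fin.zero_eta]
      rw [normalMap_single, mul_aeval_of_qcomm bgen_x_mul_z, mul_assoc, hP, aeval_smul_eq,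
        map_mul, mul_assoc]
    · obtain ⟨P, hP⟩ := exists_mul_biPow_succ (bgen_y_mul_x (p := p) (q := q)) c
      refine ⟨Finsupp.single (c + 1) (f.comp (C q⁻¹ * X) * P), ?_⟩
      simp only [Fin.mk_one]
      rw [normalMap_single, mul_aeval_of_qcomm bgen_y_mul_z, mul_assoc, hP, aeval_smul_eq,
        map_mul, mul_assoc]
    · refine ⟨Finsupp.single c (X * f), ?_⟩
      simp only [Fin.reduceFinMk]
      rw [normalMap_single, map_mul, aeval_X]

theorem normalMap_surjective : Function.Surjective (normalMap p q) := by
  intro b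
  change b ∈ LinearMap.range (normalMap p q)
  induction b using GWA_induction with
  | one => exact ⟨Finsupp.single 0 1, by simp [normalMap_single, biPow]⟩
  | bgen_mul i b hb => obtain ⟨f, rfl⟩ := hb; exact bgen_mul_normalMap_mem i f
  | add a b ha hb => exact add_mem ha hb
  | smul c b hb => exact Submodule.smul_mem _ c hb

/-- A criterion for faithfulness of a weighted-shift representation of `B(p;q,0)`. -/
theorem injective_of_shiftsSingle (hq : q ≠ 0) {ψ : GWA 𝕂 p q →ₐ[𝕂] Module.End 𝕂 (ℤ → 𝕂[X])}
    (hx : ShiftsSingle (ψ x) (-1)) (hy : ShiftsSingle (ψ y) 1)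
    (hz : ψ z = wshift (fun n => C (q ^ n) * X) 0) : Function.Injective ψ := by
  have hpow (c : ℤ) : ∃ h : 𝕂[X], h ≠ 0 ∧ ψ (biPow y x c) (Pi.single 0 1) = Pi.single c h := by
    obtain ⟨m, rfl | rfl⟩ := c.eq_nat_or_neg
    · simpa [biPow_natCast] using hy.pow m 0 1 one_ne_zero
    · simpa [biPow_neg_natCast] using hx.pow m 0 1 one_ne_zero
  choose h hne hh using hpow
  have happly (f : ℤ →₀ 𝕂[X]) (n : ℤ) :
      ψ (normalMap p q f) (Pi.single 0 1) n = (f n).comp (C (q ^ n) * X) * h n := by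
    induction f using Finsupp.induction_linear with
    | zero => simp
    | add f g hf hg => simp [hf, hg, add_mul]
    | single c f =>
      rw [normalMap_single, map_mul, ← aeval_algHom_apply, hz, aeval_wshift,
        Module.End.mul_apply, hh, wshift_apply, add_zero]
      by_cases hn : n = c
      · subst hn; simp
      · rw [Pi.single_eq_of_ne hn, Finsupp.single_eq_of_ne hn, zero_comp, mul_zero, zero_mul]
  rw [injective_iff_map_eq_zero]
  intro b hb
  obtain ⟨f, rfl⟩ := normalMap_surjective b
  suffices f = 0 by rw [this, map_zero]
  ext1 n
  have := happly f n
  rw [hb] at this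
  simpa [hne n, comp_C_mul_X_eq_zero_iff (mem_nonZeroDivisors_of_ne_zero (zpow_ne_zero n hq))]
    using this.symm

end GWANormalForm

/-- The representation of `A(p;q±)` by weighted shifts on sequences of polynomials. -/
theorem exists_wshift_rep (pt : 𝕂[X]) {qp qm : 𝕂} (hqp : qp ≠ 0) (hqm : qm ≠ 0) :
    ∃ ρ : APM 𝕂 pt qp qm →ₐ[𝕂] Module.End 𝕂 (ℤ → 𝕂[X]),
      ρ (gen pt qp qm 0) = wshift (fun n => C (qp ^ n) * X) 0 ∧
      ρ (gen pt qp qm 1) = wshift (fun n => C (qm ^ n)) 0 ∧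
      ρ (gen pt qp qm 2) = wshift (fun _ => 1) (-1) ∧
      ρ (gen pt qp qm 3) = wshift (fun n => pt.comp (C ((qp * qm) ^ (n + 1)) * X)) 1 := by
  suffices ∃ ρ : APM 𝕂 pt qp qm →ₐ[𝕂] Module.End 𝕂 (ℤ → 𝕂[X]), ∀ i, ρ (gen pt qp qm i) =
      (![wshift (fun n => C (qp ^ n) * X) 0, wshift (fun n => C (qm ^ n)) 0,
        wshift (fun _ => 1) (-1),
        wshift (fun n => pt.comp (C ((qp * qm) ^ (n + 1)) * X)) 1] :
        Fin 4 → Module.End 𝕂 (ℤ → 𝕂[X])) i by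
    obtain ⟨ρ, hρ⟩ := this
    exact ⟨ρ, hρ 0, hρ 1, hρ 2, hρ 3⟩
  refine exists_algHom_APM _ ?_ ?_ ?_ ?_ ?_ ?_ ?_
  all_goals
    simp only [Matrix.cons_val, wshift_mul, smul_wshift, aeval_wshift, add_zero, zero_add,
      neg_add_cancel, add_neg_cancel]
    congr 1
    funext n
  · ring
  · simp only [neg_add_cancel_right, one_mul, mul_zpow, map_mul]
    congr 1
    ring
  · simp only [mul_one, zpow_add_one₀ (mul_ne_zero hqp hqm), mul_zpow, map_mul]
    congr 1
    ring
  · simp only [← sub_eq_add_neg, zpow_sub_one₀ hqp, map_mul]; ring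
  · simp only [← sub_eq_add_neg, zpow_sub_one₀ hqm, map_mul]; ring
  · simp only [zpow_add_one₀ hqp, map_mul]; ring
  · simp only [zpow_add_one₀ hqm, map_mul]; ring

theorem injective_of_map_bgen {p pt : 𝕂[X]} {qp qm : 𝕂} {k : ℕ} (hpt : pt ≠ 0) (hqp : qp ≠ 0)
    (hqm : qm ≠ 0) {φ : GWA 𝕂 p (qp * qm) →ₐ[𝕂] APM 𝕂 pt qp qm}
    (hx : φ (bgen p (qp * qm) 0) = gen pt qp qm 3 * gen pt qp qm 0 ^ k)
    (hy : φ (bgen p (qp * qm) 1) = gen pt qp qm 1 ^ k * gen pt qp qm 2)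
    (hz : φ (bgen p (qp * qm) 2) = gen pt qp qm 0 * gen pt qp qm 1) :
    Function.Injective φ := by
  have hq := mul_ne_zero hqp hqm
  obtain ⟨ρ, hzp, hzm, hxp, hxm⟩ := exists_wshift_rep pt hqp hqm
  have hszp : ShiftsSingle (ρ (gen pt qp qm 0)) 0 := by
    rw [hzp]
    exact shiftsSingle_wshift (fun n => mul_ne_zero (C_ne_zero.mpr (zpow_ne_zero n hqp)) X_ne_zero)
      (add_zero 0)
  have hszm : ShiftsSingle (ρ (gen pt qp qm 1)) 0 := by
    rw [hzm]
    exact shiftsSingle_wshift (fun n => C_ne_zero.mpr (zpow_ne_zero n hqm)) (add_zero 0)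
  have hsxp : ShiftsSingle (ρ (gen pt qp qm 2)) 1 := by
    rw [hxp]
    exact shiftsSingle_wshift (fun n => one_ne_zero) (neg_add_cancel 1)
  have hsxm : ShiftsSingle (ρ (gen pt qp qm 3)) (-1) := by
    rw [hxm]
    refine shiftsSingle_wshift (fun n => ?_) (add_neg_cancel 1)
    exact (comp_C_mul_X_eq_zero_iff
      (mem_nonZeroDivisors_of_ne_zero (zpow_ne_zero _ hq))).not.mpr hpt
  have hinj : Function.Injective (ρ.comp φ) := by
    refine injective_of_shiftsSingle hq ?_ ?_ ?_
    · rw [AlgHom.comp_apply, hx, map_mul, map_pow]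
      simpa only [mul_zero, add_zero] using hsxm.mul (hszp.pow k)
    · rw [AlgHom.comp_apply, hy, map_mul, map_pow]
      simpa only [mul_zero, zero_add] using (hszm.pow k).mul hsxp
    · rw [AlgHom.comp_apply, hz, map_mul, hzp, hzm, wshift_mul]
      congr 1
      funext n
      simp only [add_zero, mul_zpow, map_mul]
      ring
  exact fun a b hab => hinj (congrArg ρ hab)

/-- the `k`-th Veronese subalgebra of `A(p;q±)` is a strongly ℤ-graded algebra
(the components are independent and satisfy `A_m A_n = A_{m+n}`), and its degree-zero part
is isomorphic to the generalized Weyl algebra `B(p;q,0)`, `q = q₊q₋`, via `x ↦ x₋z₊^k`,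
`y ↦ z₋^k x₊`, `z ↦ z₊z₋`. -/
theorem stmt7 [CharZero 𝕂] (p pt : Polynomial 𝕂) (k : ℕ) (hk : 1 ≤ k)
    (hp : p ≠ 0) (hpfac : p = Polynomial.X ^ k * pt) (hpt0 : pt.eval 0 ≠ 0)
    (qp qm : 𝕂) (hqp : qp ≠ 0) (hqm : qm ≠ 0) :
    iSupIndep (fun n : ℤ => acomp pt qp qm k (n * k)) ∧
      (∀ m n : ℤ,
        acomp pt qp qm k (m * k) * acomp pt qp qm k (n * k) = acomp pt qp qm k ((m + n) * k)) ∧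
      ∃ φ : GWA 𝕂 p (qp * qm) →ₐ[𝕂] APM 𝕂 pt qp qm,
        Function.Injective φ ∧
        φ (bgen p (qp * qm) 0) = gen pt qp qm 3 * gen pt qp qm 0 ^ k ∧
        φ (bgen p (qp * qm) 1) = gen pt qp qm 1 ^ k * gen pt qp qm 2 ∧
        φ (bgen p (qp * qm) 2) = gen pt qp qm 0 * gen pt qp qm 1 ∧
        (∀ b : GWA 𝕂 p (qp * qm), φ b ∈ acomp pt qp qm k 0) ∧
        (∀ a ∈ acomp pt qp qm k 0, ∃ b : GWA 𝕂 p (qp * qm), φ b = a) := by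
  have hk0 : (k : ℤ) ≠ 0 := by exact_mod_cast Nat.one_le_iff_ne_zero.mp hk
  refine ⟨(iSupIndep_acomp pt qp qm k).comp (mul_left_injective₀ hk0),
    acomp_mul_acomp_eq k hpt0, ?_⟩
  have hcomm : Commute (gen pt qp qm 0) (gen pt qp qm 1) := gen_zp_mul_zm pt qp qm
  have hcommu : Commute (gen pt qp qm 0 * gen pt qp qm 1) (gen pt qp qm 1 ^ k) :=
    (hcomm.mul_left (Commute.refl _)).pow_right k
  have hcommu' : Commute (gen pt qp qm 0 * gen pt qp qm 1) (gen pt qp qm 0 ^ k) :=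
    ((Commute.refl _).mul_left hcomm.symm).pow_right k
  obtain ⟨φ, hφ⟩ := exists_algHom_GWA (p := p) (q := qp * qm)
    ![gen pt qp qm 3 * gen pt qp qm 0 ^ k, gen pt qp qm 1 ^ k * gen pt qp qm 2,
      gen pt qp qm 0 * gen pt qp qm 1]
    (by
      simp only [Matrix.cons_val]
      rw [mul_assoc, ← mul_assoc (gen pt qp qm 0 ^ k), ← gen_zp_mul_zm_pow, ← mul_assoc,
        mul_pow_of_qcomm (gen_xm_mul_zp_mul_zm pt qp qm), smul_mul_assoc, mul_assoc,
        gen_xm_mul_xp, hpfac, map_mul, map_pow, aeval_X, _root_.smul_pow, smul_mul_assoc])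
    (by
      simp only [Matrix.cons_val]
      rw [mul_assoc, ← mul_assoc (gen pt qp qm 2), gen_xp_mul_xm, hpfac,
        ← (commute_aeval hcommu'.symm pt).eq, ← mul_assoc, (hcomm.symm.pow_pow k k).eq,
        ← gen_zp_mul_zm_pow, map_mul, map_pow, aeval_X])
    (by
      simp only [Matrix.cons_val]
      rw [mul_assoc, ← hcommu'.eq, ← mul_assoc, gen_xm_mul_zp_mul_zm, smul_mul_assoc, mul_assoc])
    (by
      simp only [Matrix.cons_val]
      rw [mul_assoc, gen_xp_mul_zp_mul_zm, mul_smul_comm, ← mul_assoc, ← hcommu.eq, mul_assoc])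
  have hφx : φ (bgen p (qp * qm) 0) = gen pt qp qm 3 * gen pt qp qm 0 ^ k := hφ 0
  have hφy : φ (bgen p (qp * qm) 1) = gen pt qp qm 1 ^ k * gen pt qp qm 2 := hφ 1
  have hφz : φ (bgen p (qp * qm) 2) = gen pt qp qm 0 * gen pt qp qm 1 := hφ 2
  refine ⟨φ, ?_, hφx, hφy, hφz, fun b => ?_, fun a ha => ?_⟩
  · exact injective_of_map_bgen (by rintro rfl; simp at hpt0) hqp hqm hφx hφy hφz
  · change φ b ∈ A0 pt qp qm k
    induction b using GWA_induction with
    | one => rw [map_one]; exact one_mem _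
    | bgen_mul i b hb =>
      rw [map_mul]
      refine mul_mem ?_ hb
      fin_cases i
      · exact hφx ▸ mul_mem_acomp pt qp qm k (xm_mem_acomp pt qp qm k)
          (zp_pow_mem_acomp pt qp qm k) (by simp)
      · exact hφy ▸ mul_mem_acomp pt qp qm k (zm_pow_mem_acomp pt qp qm k)
          (xp_mem_acomp pt qp qm k) (by simp)
      · exact hφz ▸ zp_mul_zm_mem_acomp pt qp qm k
    | add a b ha hb => rw [map_add]; exact add_mem ha hb
    | smul c b hb => rw [map_smul]; exact Subalgebra.smul_mem _ hb c
  · exact acomp_zero_le_subalgebra hqp hqm φ.range ⟨_, hφx⟩ ⟨_, hφy⟩ ⟨_, hφz⟩ ha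

end
end

section
/- Let 𝕂 be a field of characteristic zero, let p ∈ 𝕂[z] be a nonzero polynomial with root 0 of multiplicity k, write p(z) = z^k p̃(z), and define p̂ ∈ 𝕂[z] by p̃(z) = p̃(0) − z p̂(z). Let q_+, q_- ∈ 𝕂 be nonzero, q = q_+ q_-. In A(p;q_±), writing z = z_+ z_-, the following two identities hold: (1/p̃(0)^k)·( x_- · (Σ_{i=0}^{k−1} z^i p̂(z)^i p̃(0)^{k−1−i}) · x_+ + q^k p̂(qz)^k z_-^k z_+^k ) = 1, and (1/p̃(0)^k)·( x_+ · (Σ_{i=0}^{k−1} (qz)^i p̂(qz)^i p̃(0)^{k−1−i}) · x_- + p̂(z)^k z_+^k z_-^k ) = 1. -/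
open Polynomial FreeAlgebra

noncomputable section

variable (𝕂 : Type) [Field 𝕂]

variable {𝕂}

section Semiconj

variable {R : Type*} [Ring R] [Algebra 𝕂 R]

theorem SemiconjBy.aeval_polynomial {x a b : R} (h : SemiconjBy x a b) (f : Polynomial 𝕂) :
    SemiconjBy x (aeval a f) (aeval b f) := by
  induction f using Polynomial.induction_on' with
  | add f g hf hg => simpa using hf.add_right hg
  | monomial n c =>
    simp only [aeval_monomial]
    exact SemiconjBy.mul_right (Algebra.commutes c x).symm (h.pow_right n)

theorem geom_sum_mul_of_eq_C_sub_X_mul {c : 𝕂} {pt ph : Polynomial 𝕂}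
    (h : pt = C c - X * ph) (k : ℕ) :
    (∑ i ∈ Finset.range k, X ^ i * ph ^ i * C (c ^ (k - 1 - i))) * pt =
      C (c ^ k) - X ^ k * ph ^ k := by
  have := (Commute.all (X * ph) (C c)).geom_sum₂_mul k
  simp only [mul_pow, ← C_pow] at this
  rw [h]
  linear_combination -this

theorem SemiconjBy.mul_geom_sum_mul {c : 𝕂} {pt ph : Polynomial 𝕂} (h : pt = C c - X * ph)
    {x y a b : R} (hx : SemiconjBy x a b) (hxy : x * y = aeval b pt) (k : ℕ) :
    x * (∑ i ∈ Finset.range k, a ^ i * (aeval a ph) ^ i * algebraMap 𝕂 R (c ^ (k - 1 - i))) * y =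
      algebraMap 𝕂 R (c ^ k) - (aeval b ph) ^ k * b ^ k := by
  have hS := (hx.aeval_polynomial
    (∑ i ∈ Finset.range k, X ^ i * ph ^ i * C (c ^ (k - 1 - i)))).eq
  have hprod := congrArg (aeval b) (geom_sum_mul_of_eq_C_sub_X_mul h k)
  rw [mul_comm (X ^ k)] at hprod
  simp only [map_mul, map_sub, map_sum, map_pow (aeval _), aeval_X, aeval_C] at hS hprod
  rw [hS, mul_assoc, hxy, hprod]

end Semiconj

section Relations

variable {pt : Polynomial 𝕂} {qp qm : 𝕂}

theorem gen_zero_mul_one :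
    gen pt qp qm 0 * gen pt qp qm 1 = gen pt qp qm 1 * gen pt qp qm 0 := by
  simpa [gen] using RingQuot.mkAlgHom_rel 𝕂 (ARel.comm (pt := pt) (qp := qp) (qm := qm))

theorem gen_two_mul_three :
    gen pt qp qm 2 * gen pt qp qm 3 = aeval (gen pt qp qm 0 * gen pt qp qm 1) pt := by
  have := RingQuot.mkAlgHom_rel 𝕂 (ARel.pm (pt := pt) (qp := qp) (qm := qm))
  rwa [← aeval_algHom_apply, map_mul, map_mul] at this

theorem gen_three_mul_two :
    gen pt qp qm 3 * gen pt qp qm 2 =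
      aeval ((qp * qm) • (gen pt qp qm 0 * gen pt qp qm 1)) pt := by
  have := RingQuot.mkAlgHom_rel 𝕂 (ARel.mp (pt := pt) (qp := qp) (qm := qm))
  rwa [← aeval_algHom_apply, map_smul, map_mul, map_mul] at this

theorem semiconjBy_gen_three :
    SemiconjBy (gen pt qp qm 3) (gen pt qp qm 0 * gen pt qp qm 1)
      ((qp * qm) • (gen pt qp qm 0 * gen pt qp qm 1)) := by
  have h0 := RingQuot.mkAlgHom_rel 𝕂 (ARel.mzp (pt := pt) (qp := qp) (qm := qm))
  have h1 := RingQuot.mkAlgHom_rel 𝕂 (ARel.mzm (pt := pt) (qp := qp) (qm := qm))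
  simp only [map_mul, map_smul] at h0 h1
  rw [← gen, ← gen] at h0 h1
  rw [SemiconjBy, ← mul_assoc, h0, smul_mul_assoc, mul_assoc, h1, mul_smul_comm, smul_smul,
    smul_mul_assoc, mul_assoc]

theorem semiconjBy_gen_two (hqp : qp ≠ 0) (hqm : qm ≠ 0) :
    SemiconjBy (gen pt qp qm 2) ((qp * qm) • (gen pt qp qm 0 * gen pt qp qm 1))
      (gen pt qp qm 0 * gen pt qp qm 1) := by
  have h0 := RingQuot.mkAlgHom_rel 𝕂 (ARel.pzp (pt := pt) (qp := qp) (qm := qm))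
  have h1 := RingQuot.mkAlgHom_rel 𝕂 (ARel.pzm (pt := pt) (qp := qp) (qm := qm))
  simp only [map_mul, map_smul] at h0 h1
  rw [← gen, ← gen] at h0 h1
  rw [SemiconjBy, mul_smul_comm, ← mul_assoc, h0, smul_mul_assoc, mul_assoc, h1, mul_smul_comm,
    smul_smul, smul_smul, mul_assoc (qp * qm), ← mul_inv, mul_inv_cancel₀ (mul_ne_zero hqp hqm),
    one_smul, mul_assoc]

end Relations

/-- the two strong-connection identities in `A(p;q±)`, where `z = z₊z₋`,
`p(z) = z^k p̃(z)` and `p̃(z) = p̃(0) − z p̂(z)`. -/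
theorem stmt10 [CharZero 𝕂] (p pt ph : Polynomial 𝕂) (k : ℕ) (hk : 1 ≤ k)
    (hp : p ≠ 0) (hpfac : p = Polynomial.X ^ k * pt) (hpt0 : pt.eval 0 ≠ 0)
    (hph : pt = Polynomial.C (pt.eval 0) - Polynomial.X * ph)
    (qp qm : 𝕂) (hqp : qp ≠ 0) (hqm : qm ≠ 0) :
    letI q : 𝕂 := qp * qm
    letI A := APM 𝕂 pt qp qm
    letI z : A := gen pt qp qm 0 * gen pt qp qm 1
    (pt.eval 0 ^ k)⁻¹ •
        (gen pt qp qm 3 *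
            (∑ i ∈ Finset.range k,
              z ^ i * (aeval z ph) ^ i * algebraMap 𝕂 A (pt.eval 0 ^ (k - 1 - i))) *
            gen pt qp qm 2 +
          q ^ k • ((aeval (q • z) ph) ^ k * gen pt qp qm 1 ^ k * gen pt qp qm 0 ^ k)) = 1 ∧
      (pt.eval 0 ^ k)⁻¹ •
        (gen pt qp qm 2 *
            (∑ i ∈ Finset.range k,
              (q • z) ^ i * (aeval (q • z) ph) ^ i * algebraMap 𝕂 A (pt.eval 0 ^ (k - 1 - i))) *
            gen pt qp qm 3 +
          (aeval z ph) ^ k * gen pt qp qm 0 ^ k * gen pt qp qm 1 ^ k) = 1 := by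
  have hcomm : Commute (gen pt qp qm 0) (gen pt qp qm 1) := gen_zero_mul_one
  have hone : (pt.eval 0 ^ k)⁻¹ • algebraMap 𝕂 (APM 𝕂 pt qp qm) (pt.eval 0 ^ k) = 1 := by
    rw [Algebra.algebraMap_eq_smul_one, smul_smul, inv_mul_cancel₀ (pow_ne_zero k hpt0), one_smul]
  constructor
  · rw [semiconjBy_gen_three.mul_geom_sum_mul hph gen_three_mul_two, _root_.smul_pow, hcomm.mul_pow,
      (hcomm.pow_pow k k).eq, mul_smul_comm, mul_assoc, sub_add_cancel, hone]
  · rw [(semiconjBy_gen_two hqp hqm).mul_geom_sum_mul hph gen_two_mul_three, hcomm.mul_pow,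
      mul_assoc, sub_add_cancel, hone]

end
end

section
/- Let 𝕂 be a field of characteristic zero, let q ∈ 𝕂 be nonzero and not a root of unity, let p ∈ 𝕂[z] be a nonzero polynomial with root 0 of multiplicity k, write p(z) = z^k p̃(z), define p̂ ∈ 𝕂[z] by p̃(z) = p̃(0) − z p̂(z), and let ζ ∈ 𝕂 be a nonzero root of p. Define polynomials e_n ∈ 𝕂[z] for n ≥ 0 by e_0(z) = 1 and e_{n+1}(z) = (1/p̃(0)^k)·( (p̃(0)^k − p̂(z)^k z^k)·e_n(q^{−1}z) − (p̃(0)^k − q^k p̂(qz)^k z^k)·e_n(z) ) + e_n(z). Then for all n ≥ 0, e_n(0) = 1 and τ̂_ζ(e_n) = −n, where τ̂_ζ : 𝕂[z] → 𝕂 is the 𝕂-linear map with τ̂_ζ(1) = 0 and τ̂_ζ(z^m) = ζ^m/(1−q^m) for m ≥ 1. -/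
open Polynomial Finset

/-- The functional `z ^ m ↦ ζ ^ m / (1 - q ^ m)` inverts the `q`-difference operator up to
evaluation at `ζ` and `0`. -/
theorem constr_sub_comp_C_mul_X {𝕂 : Type*} [Field 𝕂] (q ζ : 𝕂)
    (hq : ∀ n : ℕ, n ≠ 0 → q ^ n ≠ 1) (F : Polynomial 𝕂) :
    (Polynomial.basisMonomials 𝕂).constr 𝕂
      (fun m => if m = 0 then (0 : 𝕂) else ζ ^ m / (1 - q ^ m)) (F - F.comp (C q * X)) =
      F.eval ζ - F.eval 0 := by
  induction F using Polynomial.induction_on' with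
  | add f g hf hg =>
    rw [add_comp, add_sub_add_comm, map_add, hf, hg, eval_add, eval_add]
    ring
  | monomial m a =>
    have h : monomial m a - (monomial m a).comp (C q * X) =
        (a * (1 - q ^ m)) • Polynomial.basisMonomials 𝕂 m := by
      rw [monomial_comp, mul_pow, ← C_pow, ← mul_assoc, ← C_mul, C_mul_X_pow_eq_monomial,
        ← map_sub, coe_basisMonomials, smul_monomial]
      congr 1
      simp [mul_sub]
    rw [h, map_smul, Module.Basis.constr_basis]
    rcases eq_or_ne m 0 with rfl | hm
    · simp
    · have hne : 1 - q ^ m ≠ 0 := sub_ne_zero.mpr (hq m hm).symm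
      simp only [hm, if_false, smul_eq_mul, eval_monomial, ne_eq, not_false_eq_true, zero_pow]
      field_simp
      ring

/-- the idempotent-trace polynomials `e_n` satisfy `e_n(0) = 1` and
`τ̂_ζ(e_n) = -n`. -/
theorem stmt11 {𝕂 : Type*} [Field 𝕂] [CharZero 𝕂] (q : 𝕂) (hq0 : q ≠ 0)
    (hq : ∀ n : ℕ, n ≠ 0 → q ^ n ≠ 1)
    (p pt ph : Polynomial 𝕂) (k : ℕ) (hk1 : 1 ≤ k)
    (hp : p ≠ 0) (hpfac : p = X ^ k * pt) (hpt0 : pt.eval 0 ≠ 0)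
    (hph : pt = C (pt.eval 0) - X * ph)
    (ζ : 𝕂) (hζ : ζ ≠ 0) (hroot : p.eval ζ = 0)
    (e : ℕ → Polynomial 𝕂) (he0 : e 0 = 1)
    (herec : ∀ n : ℕ, e (n + 1) =
      (pt.eval 0 ^ k)⁻¹ •
        ((C (pt.eval 0 ^ k) - ph ^ k * X ^ k) * ((e n).comp (C q⁻¹ * X)) -
          (C (pt.eval 0 ^ k) - C (q ^ k) * (ph.comp (C q * X)) ^ k * X ^ k) * e n) + e n)
    (τ : Polynomial 𝕂 →ₗ[𝕂] 𝕂)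
    (hτ : τ = (Polynomial.basisMonomials 𝕂).constr 𝕂
      (fun m => if m = 0 then 0 else ζ ^ m / (1 - q ^ m))) :
    ∀ n : ℕ, (e n).eval 0 = 1 ∧ τ (e n) = -(n : 𝕂) := by
  have hc : pt.eval 0 ^ k ≠ 0 := pow_ne_zero k hpt0
  have hk : k ≠ 0 := by omega
  have hptζ : pt.eval ζ = 0 := by
    rw [hpfac, eval_mul, eval_pow, eval_X] at hroot
    exact (mul_eq_zero.mp hroot).resolve_left (pow_ne_zero k hζ)
  have hphζ : ζ * ph.eval ζ = pt.eval 0 := by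
    have h := congrArg (eval ζ) hph
    rw [hptζ, eval_sub, eval_C, eval_mul, eval_X] at h
    exact (sub_eq_zero.mp h.symm).symm
  have hcomp : ∀ f : Polynomial 𝕂, (f.comp (C q⁻¹ * X)).comp (C q * X) = f := by
    intro f
    rw [comp_assoc, mul_comp, C_comp, X_comp, ← mul_assoc, ← C_mul, inv_mul_cancel₀ hq0, C_1,
      one_mul, comp_X]
  have hstep : ∀ n, ∃ F : Polynomial 𝕂,
      e (n + 1) = (pt.eval 0 ^ k)⁻¹ • (F - F.comp (C q * X)) + e n ∧
      F.eval 0 = pt.eval 0 ^ k * (e n).eval 0 ∧ F.eval ζ = 0 := by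
    intro n
    refine ⟨(C (pt.eval 0 ^ k) - ph ^ k * X ^ k) * (e n).comp (C q⁻¹ * X), ?_, ?_, ?_⟩
    · rw [herec n, mul_comp, hcomp, sub_comp, C_comp, mul_comp, pow_comp, pow_comp, X_comp,
        mul_pow, C_pow (a := q)]
      ring_nf
    · simp [hk]
    · rw [eval_mul, eval_sub, eval_C, eval_mul, eval_pow, eval_pow, eval_X, ← mul_pow,
        mul_comm (ph.eval ζ), hphζ, sub_self, zero_mul]
  intro n
  induction n with
  | zero =>
    refine ⟨by simp [he0], ?_⟩
    have h1 : (1 : Polynomial 𝕂) = Polynomial.basisMonomials 𝕂 0 := by simp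
    rw [he0, hτ, h1, Module.Basis.constr_basis]
    simp
  | succ n ih =>
    obtain ⟨F, hF, hF0, hFζ⟩ := hstep n
    constructor
    · rw [hF]
      simp [ih.1]
    · rw [hF, map_add, map_smul, ih.2, hτ, constr_sub_comp_C_mul_X q ζ hq, hF0, hFζ, ih.1]
      push_cast
      rw [smul_eq_mul, mul_one, zero_sub, mul_neg, inv_mul_cancel₀ hc]
      ring
end

section
/- Let 0 → K →^φ G →^π H → 0 be a short exact sequence of abelian groups and let A = ⊕_{g∈G} A_g be a G-graded algebra over a field. Let A carry the H-grading induced by π, namely A_h = ⊕_{g ∈ π^{−1}(h)} A_g for h ∈ H, and let A^{(K)} = ⊕_{k∈K} A_{φ(k)} carry the K-grading induced by φ. Then A is strongly G-graded if and only if A is strongly H-graded and A^{(K)} is strongly K-graded. -/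
/-- A grading by submodules is strong as soon as `1 ∈ A_g A_{-g}` for all `g`. -/
theorem mul_eq_of_one_mem_mul_neg {R A G : Type*} [CommSemiring R] [Semiring A] [Algebra R A]
    [AddGroup G] (𝒜 : G → Submodule R A) [SetLike.GradedMonoid 𝒜]
    (h : ∀ g, (1 : A) ∈ 𝒜 g * 𝒜 (-g)) (g g' : G) : 𝒜 g * 𝒜 g' = 𝒜 (g + g') := by
  have mul_le (a b : G) : 𝒜 a * 𝒜 b ≤ 𝒜 (a + b) :=
    Submodule.mul_le.2 fun _ hx _ hy => SetLike.mul_mem_graded hx hy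
  refine le_antisymm (mul_le g g') ?_
  calc 𝒜 (g + g') = 1 * 𝒜 (g + g') := (one_mul _).symm
    _ ≤ 𝒜 g * 𝒜 (-g) * 𝒜 (g + g') := mul_le_mul_left (Submodule.one_le.2 (h g)) _
    _ = 𝒜 g * (𝒜 (-g) * 𝒜 (g + g')) := mul_assoc _ _ _
    _ ≤ 𝒜 g * 𝒜 g' := mul_le_mul_right (by simpa using mul_le (-g) (g + g')) _

/-- If `1` is a sum of products of homogeneous elements of degrees in `s` and `t`, and all products
`A_a A_{-a}` with `a ∈ s`, `-a ∈ t` lie in `N`, then `1 ∈ N`. -/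
theorem one_mem_of_one_mem_iSup_mul_iSup {R A G : Type*} [CommSemiring R] [Semiring A]
    [Algebra R A] [AddGroup G] [DecidableEq G] (𝒜 : G → Submodule R A) [GradedAlgebra 𝒜]
    {s t : G → Prop} {N : Submodule R A}
    (hN : ∀ a, s a → t (-a) → 𝒜 a * 𝒜 (-a) ≤ N)
    (h : (1 : A) ∈ (⨆ (g : G) (_ : s g), 𝒜 g) * (⨆ (g : G) (_ : t g), 𝒜 g)) :
    (1 : A) ∈ N := by
  have hle : (⨆ (g : G) (_ : s g), 𝒜 g) * (⨆ (g : G) (_ : t g), 𝒜 g) ≤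
      N.comap (GradedAlgebra.proj 𝒜 0) := by
    simp only [Submodule.iSup_mul, Submodule.mul_iSup]
    refine iSup₂_le fun b hb => iSup₂_le fun a ha => ?_
    refine Submodule.mul_le.2 fun x hx y hy => ?_
    have hxy := SetLike.mul_mem_graded hx hy
    rw [Submodule.mem_comap, GradedAlgebra.proj_apply]
    by_cases hab : a + b = 0
    · obtain rfl : b = -a := (neg_eq_of_add_eq_zero_right hab).symm
      rw [hab] at hxy
      rw [DirectSum.decompose_of_mem_same 𝒜 hxy]
      exact hN a ha hb (Submodule.mul_mem_mul hx hy)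
    · rw [DirectSum.decompose_of_mem_ne 𝒜 hxy hab]
      exact N.zero_mem
  have h1 := hle h
  rwa [Submodule.mem_comap, GradedAlgebra.proj_apply,
    DirectSum.decompose_of_mem_same 𝒜 (SetLike.one_mem_graded 𝒜)] at h1

/-- given a short exact sequence of abelian groups
`0 → K →φ G →π H → 0` and a `G`-graded algebra `A`, the grading is strong if and only if
the induced `H`-grading on `A` and the induced `K`-grading on `A^(K) = ⊕_{k∈K} A_{φ(k)}`
are both strong. -/
theorem stmt12 {𝕂 A : Type*} [Field 𝕂] [Ring A] [Algebra 𝕂 A]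
    {K G H : Type*} [AddCommGroup K] [AddCommGroup G] [AddCommGroup H] [DecidableEq G]
    (φ : K →+ G) (π : G →+ H)
    (hφ : Function.Injective φ) (hπ : Function.Surjective π)
    (hexact : ∀ g : G, π g = 0 ↔ g ∈ Set.range φ)
    (𝒜 : G → Submodule 𝕂 A) [GradedAlgebra 𝒜] :
    (∀ g g' : G, 𝒜 g * 𝒜 g' = 𝒜 (g + g')) ↔
      ((∀ h h' : H,
          (⨆ (g : G) (_ : π g = h), 𝒜 g) * (⨆ (g : G) (_ : π g = h'), 𝒜 g) =
            ⨆ (g : G) (_ : π g = h + h'), 𝒜 g) ∧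
        (∀ k k' : K, 𝒜 (φ k) * 𝒜 (φ k') = 𝒜 (φ (k + k')))) := by
  have mul_le (a b : G) : 𝒜 a * 𝒜 b ≤ 𝒜 (a + b) :=
    Submodule.mul_le.2 fun _ hx _ hy => SetLike.mul_mem_graded hx hy
  constructor
  · intro hs
    refine ⟨fun h h' => le_antisymm ?_ ?_, fun k k' => by rw [hs, map_add]⟩
    · simp only [Submodule.iSup_mul, Submodule.mul_iSup]
      refine iSup₂_le fun b hb => iSup₂_le fun a ha => ?_
      exact (mul_le a b).trans
        (le_iSup₂_of_le (a + b) (by simp [ha, hb]) le_rfl)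
    · refine iSup₂_le fun g hg => ?_
      obtain ⟨a, rfl⟩ := hπ h
      have hga : 𝒜 g = 𝒜 a * 𝒜 (-a + g) := by rw [hs, add_neg_cancel_left]
      rw [hga]
      exact mul_le_mul' (le_iSup₂_of_le a rfl le_rfl)
        (le_iSup₂_of_le (-a + g) (by simp [hg]) le_rfl)
  · rintro ⟨hH, hK⟩
    refine mul_eq_of_one_mem_mul_neg 𝒜 fun g => ?_
    refine one_mem_of_one_mem_iSup_mul_iSup 𝒜 (s := fun a => π a = π g)
      (t := fun b => π b = -π g) (fun a ha _ => ?_) ?_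
    · obtain ⟨k, hk⟩ := (hexact (g - a)).1 (by simp [ha])
      have hone : (1 : Submodule 𝕂 A) ≤ 𝒜 (φ k) * 𝒜 (φ (-k)) := by
        rw [hK, add_neg_cancel, map_zero]
        exact Submodule.one_le.2 (SetLike.one_mem_graded 𝒜)
      calc 𝒜 a * 𝒜 (-a) = 𝒜 a * 1 * 𝒜 (-a) := by rw [mul_one]
        _ ≤ 𝒜 a * (𝒜 (φ k) * 𝒜 (φ (-k))) * 𝒜 (-a) := by gcongr
        _ = 𝒜 a * 𝒜 (φ k) * (𝒜 (φ (-k)) * 𝒜 (-a)) := by simp only [mul_assoc]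
        _ ≤ 𝒜 (a + φ k) * 𝒜 (φ (-k) + -a) := mul_le_mul' (mul_le _ _) (mul_le _ _)
        _ = 𝒜 g * 𝒜 (-g) := by rw [map_neg, hk]; congr 2 <;> abel
    · rw [hH]
      exact le_iSup₂_of_le (f := fun (a : G) (_ : π a = π g + -π g) => 𝒜 a) 0 (by simp) le_rfl
        (SetLike.one_mem_graded 𝒜)
end

section
/- Let 𝕂 be a field of characteristic zero, let p ∈ 𝕂[z] be a nonzero polynomial with root 0 of multiplicity k ≥ 2, and let q_+, q_- ∈ 𝕂 be nonzero. Then the ℤ-graded algebra A(p;q_±), graded by deg z_± = ±1 and deg x_± = ±k, is not strongly graded; in particular A(p;q_±)_1 · A(p;q_±)_{−1} ≠ A(p;q_±)_0. -/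
open Polynomial FreeAlgebra

noncomputable section

variable (𝕂 : Type) [Field 𝕂]

variable {𝕂}

/-- The character of `A(p;q±)` with `z₊, z₋ ↦ 0`, `x₊ ↦ p̃(0)` and `x₋ ↦ 1`. -/
def zeroChar (pt : Polynomial 𝕂) (qp qm : 𝕂) : APM 𝕂 pt qp qm →ₐ[𝕂] 𝕂 :=
  RingQuot.liftAlgHom 𝕂
    ⟨FreeAlgebra.lift 𝕂 ![0, 0, pt.eval 0, 1], by
      intro x y h
      induction h <;> simp [Polynomial.aeval_def, Polynomial.coeff_zero_eq_eval_zero]⟩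

theorem zeroChar_gen (pt : Polynomial 𝕂) (qp qm : 𝕂) (i : Fin 4) :
    zeroChar pt qp qm (gen pt qp qm i) = (![0, 0, pt.eval 0, 1] : Fin 4 → 𝕂) i := by
  simp [zeroChar, gen]

/-- The character `zeroChar` vanishes on monomials whose degree is not a multiple of `k`. -/
theorem zeroChar_prod_eq_zero (pt : Polynomial 𝕂) (qp qm : 𝕂) (k : ℕ) (l : List (Fin 4))
    (hl : ¬ (k : ℤ) ∣ (l.map (gdeg k)).sum) :
    zeroChar pt qp qm (l.map (gen pt qp qm)).prod = 0 := by
  induction l with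
  | nil => simp at hl
  | cons i l ih =>
    rw [List.map_cons, List.prod_cons, map_mul, zeroChar_gen]
    rw [List.map_cons, List.sum_cons] at hl
    fin_cases i
    · simp
    · simp
    · rw [ih fun h => hl (dvd_add (by simp [gdeg]) h), mul_zero]
    · rw [ih fun h => hl (dvd_add (by simp [gdeg]) h), mul_zero]

theorem zeroChar_eq_zero_of_mem_acomp {pt : Polynomial 𝕂} {qp qm : 𝕂} {k : ℕ} {n : ℤ}
    (hn : ¬ (k : ℤ) ∣ n) {a : APM 𝕂 pt qp qm} (ha : a ∈ acomp pt qp qm k n) :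
    zeroChar pt qp qm a = 0 := by
  have hle : acomp pt qp qm k n ≤ LinearMap.ker (zeroChar pt qp qm).toLinearMap := by
    refine Submodule.span_le.2 ?_
    rintro _ ⟨l, rfl, rfl⟩
    exact zeroChar_prod_eq_zero pt qp qm k l hn
  exact hle ha

theorem one_mem_acomp_zero (pt : Polynomial 𝕂) (qp qm : 𝕂) (k : ℕ) :
    1 ∈ acomp pt qp qm k 0 :=
  Submodule.subset_span ⟨[], by simp, by simp⟩

theorem one_notMem_acomp_mul {pt : Polynomial 𝕂} {qp qm : 𝕂} {k : ℕ} {m n : ℤ}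
    (hm : ¬ (k : ℤ) ∣ m) : 1 ∉ acomp pt qp qm k m * acomp pt qp qm k n := by
  have hle : acomp pt qp qm k m * acomp pt qp qm k n ≤
      LinearMap.ker (zeroChar pt qp qm).toLinearMap := by
    refine Submodule.mul_le.2 fun a ha b _ => ?_
    simp [zeroChar_eq_zero_of_mem_acomp hm ha]
  intro h
  simpa using hle h

/-- if `0` is a root of `p` of multiplicity `k ≥ 2`, then the ℤ-graded algebra
`A(p;q±)` is not strongly graded; in particular `A_1 · A_{-1} ≠ A_0`. -/
theorem stmt13 [CharZero 𝕂] (p pt : Polynomial 𝕂) (k : ℕ) (hk : 2 ≤ k)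
    (hp : p ≠ 0) (hpfac : p = Polynomial.X ^ k * pt) (hpt0 : pt.eval 0 ≠ 0)
    (qp qm : 𝕂) (hqp : qp ≠ 0) (hqm : qm ≠ 0) :
    ¬ (∀ m n : ℤ, acomp pt qp qm k m * acomp pt qp qm k n = acomp pt qp qm k (m + n)) ∧
      acomp pt qp qm k 1 * acomp pt qp qm k (-1) ≠ acomp pt qp qm k 0 := by
  have hne : acomp pt qp qm k 1 * acomp pt qp qm k (-1) ≠ acomp pt qp qm k 0 := by
    intro h
    have hk1 : ¬ (k : ℤ) ∣ 1 := by
      intro hd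
      have := Int.le_of_dvd one_pos hd
      omega
    exact one_notMem_acomp_mul hk1 (h ▸ one_mem_acomp_zero pt qp qm k)
  exact ⟨fun h => hne (by simpa using h 1 (-1)), hne⟩

end
end

section
/- Let 𝕂 be a field of characteristic zero, let p ∈ 𝕂[z] be a nonzero polynomial with root 0 of multiplicity k ≥ 2, let q_+, q_- ∈ 𝕂 be nonzero, and suppose q = q_+ q_- is not a root of unity and p has a nonzero root. Then the ℤ/kℤ-grading of A(p;q_±) induced from its ℤ-grading by reduction of degrees modulo k is not strong. -/
open Polynomial FreeAlgebra

noncomputable section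

variable (𝕂 : Type) [Field 𝕂]

variable {𝕂}

/-- The component of the induced `ℤ/kℤ`-grading of `A(p;q±)`:
`A_{[j]} = ⊕_{n ≡ j mod k} A_n`. -/
def zmodComp (pt : Polynomial 𝕂) (qp qm : 𝕂) (k : ℕ) (j : ZMod k) :
    Submodule 𝕂 (APM 𝕂 pt qp qm) :=
  ⨆ (n : ℤ) (_ : (n : ZMod k) = j), acomp pt qp qm k n

/-- The character of `A(p;q±)` sending `z₊` and `z₋` to `0`, `x₊` to `1` and `x₋` to `p̃(0)`. -/
def augmentation (pt : Polynomial 𝕂) (qp qm : 𝕂) : APM 𝕂 pt qp qm →ₐ[𝕂] 𝕂 :=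
  RingQuot.liftAlgHom 𝕂 ⟨FreeAlgebra.lift 𝕂 ![0, 0, 1, pt.eval 0], by
    intro a b h
    induction h <;> simp [← Polynomial.aeval_algHom_apply, Polynomial.coe_aeval_eq_eval]⟩

lemma augmentation_gen (pt : Polynomial 𝕂) (qp qm : 𝕂) (i : Fin 4) :
    augmentation pt qp qm (gen pt qp qm i) = ![0, 0, 1, pt.eval 0] i := by
  simp [augmentation, gen]

lemma augmentation_list_prod (pt : Polynomial 𝕂) (qp qm : 𝕂) (k : ℕ) (l : List (Fin 4))
    (hl : (((l.map (gdeg k)).sum : ℤ) : ZMod k) ≠ 0) :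
    augmentation pt qp qm (l.map (gen pt qp qm)).prod = 0 := by
  induction l with
  | nil => simp at hl
  | cons i l ih =>
    rw [List.map_cons, List.prod_cons, map_mul, augmentation_gen]
    fin_cases i
    · simp
    · simp
    all_goals
      rw [ih, mul_zero]
      simpa [gdeg] using hl

lemma zmodComp_le_ker_augmentation (pt : Polynomial 𝕂) (qp qm : 𝕂) (k : ℕ) {j : ZMod k}
    (hj : j ≠ 0) :
    zmodComp pt qp qm k j ≤ LinearMap.ker (augmentation pt qp qm).toLinearMap := by
  refine iSup₂_le fun n hn => Submodule.span_le.2 ?_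
  rintro _ ⟨l, rfl, rfl⟩
  exact augmentation_list_prod pt qp qm k l (hn ▸ hj)

lemma one_mem_zmodComp_zero (pt : Polynomial 𝕂) (qp qm : 𝕂) (k : ℕ) :
    1 ∈ zmodComp pt qp qm k 0 :=
  Submodule.mem_iSup_of_mem 0 <| Submodule.mem_iSup_of_mem (by simp) <|
    Submodule.subset_span ⟨[], by simp, by simp⟩

/-- if `0` is a root of `p` of multiplicity `k ≥ 2`, `q = q₊q₋` is not a root of
unity and `p` has a nonzero root, then the `ℤ/kℤ`-grading of `A(p;q±)` induced from its
ℤ-grading by reduction of degrees modulo `k` is not strong. -/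
theorem stmt14 [CharZero 𝕂] (p pt : Polynomial 𝕂) (k : ℕ) (hk : 2 ≤ k)
    (hp : p ≠ 0) (hpfac : p = Polynomial.X ^ k * pt) (hpt0 : pt.eval 0 ≠ 0)
    (qp qm : 𝕂) (hqp : qp ≠ 0) (hqm : qm ≠ 0)
    (hq : ∀ n : ℕ, n ≠ 0 → (qp * qm) ^ n ≠ 1)
    (hroot : ∃ ζ : 𝕂, ζ ≠ 0 ∧ p.eval ζ = 0) :
    ¬ (∀ g h : ZMod k,
        zmodComp pt qp qm k g * zmodComp pt qp qm k h = zmodComp pt qp qm k (g + h)) := by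
  intro h
  have : Fact (1 < k) := ⟨hk⟩
  have hone : (1 : APM 𝕂 pt qp qm) ∈ zmodComp pt qp qm k 1 * zmodComp pt qp qm k (-1) := by
    rw [h, add_neg_cancel]
    exact one_mem_zmodComp_zero pt qp qm k
  have hle : zmodComp pt qp qm k 1 * zmodComp pt qp qm k (-1) ≤
      LinearMap.ker (augmentation pt qp qm).toLinearMap := by
    refine Submodule.mul_le.2 fun a ha b _ => ?_
    have ha0 : augmentation pt qp qm a = 0 :=
      zmodComp_le_ker_augmentation pt qp qm k one_ne_zero ha
    simp [ha0]
  have h10 : augmentation pt qp qm 1 = 0 := hle hone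
  simp at h10

end
end

section
/- Let p be a nonzero polynomial with real coefficients, let q ∈ (0,1), and let ζ be a real root of p such that p(q^k ζ) > 0 for all positive integers k. Let (e_k)_{k∈ℕ} be the standard orthonormal basis of the Hilbert space ℓ²(ℕ). Then the bounded operators Z, X on ℓ²(ℕ) defined by Z e_k = q^k ζ e_k and X e_k = √(p(q^k ζ)) e_{k−1} (with X e_0 = 0), together with Y = X*, satisfy X Y = p(qZ), Y X = p(Z), X Z = q Z X, and Y Z = q^{−1} Z Y; moreover Z is self-adjoint. In other words, x ↦ X, y ↦ Y, z ↦ Z defines a bounded *-representation of the complex generalized Weyl algebra B(p;q,0) with z* = z, y* = x. -/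
open Polynomial

noncomputable section

/-- The Hilbert space `ℓ²(ℕ)`. -/
abbrev l2N : Type := lp (fun _ : ℕ => ℂ) 2

/-- The standard orthonormal basis vectors of `ℓ²(ℕ)`. -/
def eVec (k : ℕ) : l2N := lp.single 2 k (1 : ℂ)

lemma clm_ext_eVec {S T : l2N →L[ℂ] l2N} (h : ∀ k, S (eVec k) = T (eVec k)) : S = T := by
  refine lp.ext_continuousLinearMap (by norm_num) fun k => ?_
  refine ContinuousLinearMap.ext_ring ?_
  exact h k

lemma inner_eVec (k : ℕ) (f : l2N) : inner ℂ (eVec k) f = f k := by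
  rw [eVec, lp.inner_single_left]
  simp

lemma l2_ext_inner {f g : l2N} (h : ∀ k, inner ℂ (eVec k) f = inner ℂ (eVec k) g) : f = g := by
  ext k
  simpa only [inner_eVec] using h k

lemma inner_eVec_eVec (j k : ℕ) : inner ℂ (eVec j) (eVec k) = if j = k then (1 : ℂ) else 0 := by
  rw [inner_eVec, eVec, lp.single_apply]
  simp [Pi.single_apply]

lemma aeval_clm_apply_of_apply_eq_smul (P : ℂ[X]) (T : l2N →L[ℂ] l2N) (v : l2N) (c : ℂ) (h : T v = c • v) :
    aeval T P v = P.eval c • v := by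
  induction P using Polynomial.induction_on' with
  | add P Q hP hQ => simp [hP, hQ, add_smul]
  | monomial n a =>
    have hpow : (T ^ n) v = c ^ n • v := by
      induction n with
      | zero => simp
      | succ n ih => rw [pow_succ', mul_apply_eq_comp, ih, map_smul, h, smul_smul, pow_succ]
    simp [aeval_monomial, hpow, Algebra.algebraMap_eq_smul_one, mul_smul]

lemma aeval_map_real_apply_of_apply_eq_smul (p : ℝ[X]) (T : l2N →L[ℂ] l2N) (v : l2N) (c : ℝ)
    (h : T v = (c : ℂ) • v) :
    aeval T (p.map (algebraMap ℝ ℂ)) v = ((p.eval c : ℝ) : ℂ) • v := by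
  rw [aeval_clm_apply_of_apply_eq_smul _ T v c h, ← Complex.coe_algebraMap, eval_map_apply]

/-- the operators `Z, X` on `ℓ²(ℕ)` given by `Z e_k = q^k ζ e_k`,
`X e_0 = 0`, `X e_k = √(p(q^k ζ)) e_{k-1}`, together with `Y = X*`, give a bounded
`*`-representation of `B(p;q,0)`: they satisfy `XY = p(qZ)`, `YX = p(Z)`, `XZ = qZX`,
`YZ = q⁻¹ZY`, and `Z` is self-adjoint. -/
theorem stmt17 (p : Polynomial ℝ) (hp : p ≠ 0) (q : ℝ) (hq : q ∈ Set.Ioo (0:ℝ) 1)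
    (ζ : ℝ) (hζ : p.eval ζ = 0) (hpos : ∀ k : ℕ, 0 < k → 0 < p.eval (q ^ k * ζ))
    (Z X : l2N →L[ℂ] l2N)
    (hZ : ∀ k : ℕ, Z (eVec k) = (((q : ℂ) ^ k * (ζ : ℂ))) • eVec k)
    (hX0 : X (eVec 0) = 0)
    (hX : ∀ k : ℕ, X (eVec (k + 1)) =
      ((Real.sqrt (p.eval (q ^ (k + 1) * ζ)) : ℝ) : ℂ) • eVec k)
    (Y : l2N →L[ℂ] l2N) (hY : Y = ContinuousLinearMap.adjoint X) :
    X * Y = aeval ((q : ℂ) • Z) (p.map (algebraMap ℝ ℂ)) ∧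
      Y * X = aeval Z (p.map (algebraMap ℝ ℂ)) ∧
      X * Z = (q : ℂ) • (Z * X) ∧
      Y * Z = (q : ℂ)⁻¹ • (Z * Y) ∧
      IsSelfAdjoint Z := by
  have hq0 : (q : ℂ) ≠ 0 := by exact_mod_cast hq.1.ne'
  have hZr (k : ℕ) : Z (eVec k) = ((q ^ k * ζ : ℝ) : ℂ) • eVec k := by
    rw [hZ]; push_cast; rfl
  have hYe (k : ℕ) : Y (eVec k) =
      ((Real.sqrt (p.eval (q ^ (k + 1) * ζ)) : ℝ) : ℂ) • eVec (k + 1) := by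
    refine l2_ext_inner fun j => ?_
    rw [hY, ContinuousLinearMap.adjoint_inner_right, inner_smul_right, inner_eVec_eVec]
    cases j with
    | zero => simp [hX0]
    | succ j =>
      rw [hX, inner_smul_left, inner_eVec_eVec]
      by_cases h : j = k <;> simp [h]
  have hsq (k : ℕ) : ((Real.sqrt (p.eval (q ^ (k + 1) * ζ)) : ℝ) : ℂ) *
      ((Real.sqrt (p.eval (q ^ (k + 1) * ζ)) : ℝ) : ℂ) =
      ((p.eval (q ^ (k + 1) * ζ) : ℝ) : ℂ) := by
    rw [← Complex.ofReal_mul, Real.mul_self_sqrt (hpos _ k.succ_pos).le]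
  refine ⟨clm_ext_eVec fun k => ?_, clm_ext_eVec fun k => ?_, clm_ext_eVec fun k => ?_,
    clm_ext_eVec fun k => ?_, ?_⟩
  · rw [aeval_map_real_apply_of_apply_eq_smul p _ _ (q ^ (k + 1) * ζ), mul_apply_eq_comp, hYe, map_smul,
      hX, smul_smul, hsq]
    rw [smul_apply, hZ, smul_smul]
    push_cast
    ring_nf
  · rw [aeval_map_real_apply_of_apply_eq_smul p _ _ _ (hZr k), mul_apply_eq_comp]
    cases k with
    | zero => simp [hX0, hζ]
    | succ k => rw [hX, map_smul, hYe, smul_smul, hsq]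
  · rw [smul_apply, mul_apply_eq_comp,
      mul_apply_eq_comp, hZ, map_smul]
    cases k with
    | zero => simp [hX0]
    | succ k =>
      rw [hX, map_smul, hZ, smul_smul, smul_smul, smul_smul]
      ring_nf
  · rw [smul_apply, mul_apply_eq_comp,
      mul_apply_eq_comp, hZ, map_smul, hYe, map_smul, hZ, smul_smul, smul_smul,
      smul_smul]
    congr 1
    field_simp
    ring
  · rw [ContinuousLinearMap.isSelfAdjoint_iff']
    refine clm_ext_eVec fun k => l2_ext_inner fun j => ?_
    rw [ContinuousLinearMap.adjoint_inner_right, hZr, hZr, inner_smul_left, inner_smul_right,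
      inner_eVec_eVec]
    by_cases h : j = k <;> simp [h]

end
end
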